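/- Let m ≥ 1 and K ≥ 1 be integers and let f₁, …, f_K : ℝ^m → ℝ be functions such that each f_k is real analytic on ℝ^m and such that the constant function 1 together with f₁, …, f_K are linearly independent over ℝ in the vector space of functions from ℝ^m to ℝ. Then for Lebesgue-almost every h̃ ∈ ℝ^m, the vector h := (f₁(h̃), …, f_K(h̃)) ∈ ℝ^K satisfies limsup_{SNR → ∞} R₁(h; SNR) / ((1/2)·log₂(1 + SNR)) ≤ 1/K, where R₁(h; SNR) := sup over a ∈ ℤ^K ∖ {0} of (1/2)·log₂(SNR / σ²_eff(h, a; SNR)). -/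

import Mathlib

open Finset MeasureTheory

/-- A function with `|F⁽ᵏ⁾|` pinched between `c` and `L c` that is small at `2 ^ k` separated
points is small on the whole interval. Here `F i` is the `i`-th derivative of `F 0`. -/
theorem abs_le_of_separated_points {L c : ℝ} (hL : 0 ≤ L) (hc : 0 < c) {a b γ : ℝ} (hγ : 0 < γ)
    (hγab : γ ≤ b - a) (k : ℕ) :
    ∀ (F : ℕ → ℝ → ℝ) (_ : ∀ i y, HasDerivAt (F i) (F (i + 1) y) y) (ε : ℝ) (x : ℕ → ℝ)
      (_ : ∀ i < 2 ^ k, x i ∈ Set.Icc a b) (_ : ∀ i j, i < j → j < 2 ^ k → x i + γ ≤ x j)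
      (_ : ∀ i < 2 ^ k, |F 0 (x i)| ≤ ε)
      (_ : ∀ y ∈ Set.Icc a b, c ≤ |F k y| ∧ |F k y| ≤ L * c),
      ∀ y ∈ Set.Icc a b, |F 0 y| ≤ (L + 1) * 3 ^ k * ε * ((b - a) / γ) ^ k := by
  induction k with
  | zero =>
    intro F _ ε x hx _ hε hF y hy
    have h1 := hF (x 0) (hx 0 (by simp))
    have h2 := hε 0 (by simp)
    have h3 := hF y hy
    simp only [pow_zero, mul_one]
    nlinarith
  | succ k ih =>
    intro F hd ε x hx hsep hε hF y hy
    have h2k : ∀ i, i < 2 ^ k → 2 * i + 1 < 2 ^ (k + 1) := by intro i hi; rw [pow_succ]; omega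
    have hmvt : ∀ i, ∃ z, i < 2 ^ k → x (2 * i) < z ∧ z < x (2 * i + 1) ∧
        |F 1 z| ≤ 2 * ε / γ := by
      intro i
      by_cases hi : i < 2 ^ k
      swap
      · exact ⟨0, fun h => absurd h hi⟩
      have hlt := h2k i hi
      have hs := hsep (2 * i) (2 * i + 1) (by omega) hlt
      obtain ⟨z, hz, hz'⟩ := exists_hasDerivAt_eq_slope (F 0) (F 1)
        (show x (2 * i) < x (2 * i + 1) by linarith)
        (fun y _ => (hd 0 y).continuousAt.continuousWithinAt) (fun y _ => hd 0 y)
      refine ⟨z, fun _ => ⟨hz.1, hz.2, ?_⟩⟩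
      have e1 := hε (2 * i) (by omega)
      have e2 := hε (2 * i + 1) hlt
      have hpos : 0 < x (2 * i + 1) - x (2 * i) := by linarith
      rw [hz', abs_div, abs_of_pos hpos]
      have : |F 0 (x (2 * i + 1)) - F 0 (x (2 * i))| ≤ 2 * ε := by
        have := abs_sub (F 0 (x (2 * i + 1))) (F 0 (x (2 * i)))
        linarith
      have hε0 : 0 ≤ 2 * ε := (abs_nonneg _).trans this
      calc _ ≤ 2 * ε / (x (2 * i + 1) - x (2 * i)) := by gcongr
        _ ≤ _ := by gcongr; linarith
    choose z hz using hmvt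
    have hmem : ∀ i < 2 ^ k, z i ∈ Set.Icc a b := fun i hi =>
      ⟨(hx _ (by have := h2k i hi; omega)).1.trans (hz i hi).1.le,
        (hz i hi).2.1.le.trans (hx _ (h2k i hi)).2⟩
    have hsup := ih (fun i => F (i + 1)) (fun i => hd (i + 1)) (2 * ε / γ) z hmem
      (by
        intro i j hij hj
        have := hsep (2 * i + 1) (2 * j) (by omega) (by have := h2k j hj; omega)
        have h1 := (hz i (hij.trans hj)).2.1
        have h2 := (hz j hj).1
        linarith)
      (fun i hi => (hz i hi).2.2) hF
    have hx0 := hx 0 (by positivity)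
    have he0 := hε 0 (by positivity)
    have hε0 : 0 ≤ ε := (abs_nonneg _).trans he0
    have hlip := (convex_Icc a b).norm_image_sub_le_of_norm_hasDerivWithin_le
      (fun y _ => (hd 0 y).hasDerivWithinAt) hsup hx0 hy
    have hba : 0 < b - a := by linarith
    have hR : 1 ≤ (b - a) / γ := by rwa [one_le_div hγ]
    have hRk : 1 ≤ ((b - a) / γ) ^ (k + 1) := one_le_pow₀ hR
    have hdist : |y - x 0| ≤ b - a := by
      rw [abs_le]; constructor <;> linarith [hx0.1, hx0.2, hy.1, hy.2]
    simp only [Real.norm_eq_abs] at hlip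
    have h3 : |F 0 y| ≤ ε + (L + 1) * 3 ^ k * (2 * ε / γ) * ((b - a) / γ) ^ k * (b - a) := by
      have h4 : |F 0 y| ≤ |F 0 y - F 0 (x 0)| + |F 0 (x 0)| := by
        have := abs_add_le (F 0 y - F 0 (x 0)) (F 0 (x 0)); simpa using this
      have h5 : (L + 1) * 3 ^ k * (2 * ε / γ) * ((b - a) / γ) ^ k * |y - x 0| ≤
        (L + 1) * 3 ^ k * (2 * ε / γ) * ((b - a) / γ) ^ k * (b - a) := by gcongr
      linarith
    refine h3.trans ?_
    have h6 : (L + 1) * 3 ^ k * (2 * ε / γ) * ((b - a) / γ) ^ k * (b - a) =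
      2 * ((L + 1) * 3 ^ k) * (ε * ((b - a) / γ) ^ (k + 1)) := by rw [pow_succ]; ring
    rw [h6]
    have h7 : ε ≤ ε * ((b - a) / γ) ^ (k + 1) := le_mul_of_one_le_right hε0 hRk
    have h8 : 1 ≤ (L + 1) * 3 ^ k := by
      have : (1 : ℝ) ≤ 3 ^ k := one_le_pow₀ (by norm_num)
      nlinarith
    have h9 : (L + 1) * 3 ^ (k + 1) * ε * ((b - a) / γ) ^ (k + 1) =
      3 * ((L + 1) * 3 ^ k) * (ε * ((b - a) / γ) ^ (k + 1)) := by rw [pow_succ 3]; ring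
    rw [h9]
    nlinarith

/-- A set of large outer measure contains many separated points. -/
theorem exists_separated_points {γ : ℝ} (hγ : 0 < γ) (n : ℕ) :
    ∀ (T : Set ℝ) (_ : BddBelow T) (_ : ENNReal.ofReal (2 * γ * n) < volume T),
      ∃ x : ℕ → ℝ, (∀ i ≤ n, x i ∈ T) ∧ ∀ i j, i < j → j ≤ n → x i + γ ≤ x j := by
  induction n with
  | zero =>
    intro T _ hT
    obtain ⟨x, hx⟩ := nonempty_of_measure_ne_zero (ne_bot_of_gt hT)
    exact ⟨fun _ => x, fun _ _ => hx, fun i j _ _ => by omega⟩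
  | succ n ih =>
    intro T hT hv
    obtain ⟨x₁, hx₁⟩ := nonempty_of_measure_ne_zero (ne_bot_of_gt hv)
    obtain ⟨x, hxT, hx⟩ := exists_lt_of_csInf_lt ⟨x₁, hx₁⟩ (show sInf T < sInf T + γ by linarith)
    have hsub : T ⊆ Set.Icc (sInf T) (sInf T + 2 * γ) ∪ (T ∩ Set.Ici (x + γ)) := by
      intro y hy
      rcases le_or_gt (x + γ) y with h | h
      · exact Or.inr ⟨hy, h⟩
      · exact Or.inl ⟨csInf_le hT hy, by linarith⟩
    have hle := (measure_mono hsub).trans (measure_union_le (μ := volume) _ _)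
    rw [Real.volume_Icc] at hle
    have hlt : ENNReal.ofReal (2 * γ * n) < volume (T ∩ Set.Ici (x + γ)) := by
      by_contra! hcon
      refine absurd (hv.trans_le (hle.trans (add_le_add_right hcon _))) ?_
      rw [← ENNReal.ofReal_add (by linarith) (by positivity), not_lt]
      apply ENNReal.ofReal_le_ofReal
      push_cast; linarith
    obtain ⟨z, hz, hsep⟩ := ih _ (hT.mono Set.inter_subset_left) hlt
    refine ⟨fun i => Nat.casesOn i x z, ?_, ?_⟩
    · rintro (_ | i) hi
      · exact hxT
      · exact (hz i (by omega)).1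
    · rintro (_ | i) (_ | j) hij hj
      · omega
      · exact (hz j (by omega)).2
      · omega
      · exact hsep i j (by omega) (by omega)

/-- Sublevel set estimate for a function one of whose derivatives is pinched. -/
theorem volume_sublevel_le {L c : ℝ} (hL : 0 ≤ L) (hc : 0 < c) {a b : ℝ} (hab : a < b) {k D : ℕ}
    (hkD : k ≤ D) (F : ℕ → ℝ → ℝ) (hd : ∀ i y, HasDerivAt (F i) (F (i + 1) y) y)
    (hF : ∀ y ∈ Set.Icc a b, c ≤ |F k y| ∧ |F k y| ≤ L * c) {ε ρ τ : ℝ} (hτ : 0 < τ) (hτ1 : τ ≤ 1)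
    (hε : (L + 1) * 3 ^ D * 2 ^ ((D + 1) * D) * ε < ρ * τ ^ D)
    (hρ : ∃ y ∈ Set.Icc a b, ρ ≤ |F 0 y|) :
    volume {x | x ∈ Set.Ioo a b ∧ |F 0 x| < ε} ≤ ENNReal.ofReal (τ * (b - a)) := by
  by_contra! hcon
  obtain ⟨y, hy, hyρ⟩ := hρ
  have hba : 0 < b - a := sub_pos.2 hab
  set γ : ℝ := τ * (b - a) / (2 * 2 ^ k) with hγdef
  have hγ : 0 < γ := by positivity
  have hγab : γ ≤ b - a := by
    rw [hγdef, div_le_iff₀ (by positivity)]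
    have : (1 : ℝ) ≤ 2 ^ k := one_le_pow₀ (by norm_num)
    nlinarith
  have hcon' : ENNReal.ofReal (2 * γ * (2 ^ k : ℕ)) <
      volume {x | x ∈ Set.Ioo a b ∧ |F 0 x| < ε} := by
    convert hcon using 2
    rw [hγdef]; push_cast; field_simp
  obtain ⟨x, hxT, hsep⟩ := exists_separated_points hγ (2 ^ k) _
    ⟨a, fun z hz => hz.1.1.le⟩ hcon'
  have hmain := abs_le_of_separated_points hL hc hγ hγab k F hd ε x
    (fun i hi => Set.Ioo_subset_Icc_self (hxT i hi.le).1) (fun i j hij hj => hsep i j hij hj.le)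
    (fun i hi => (hxT i hi.le).2.le) hF y hy
  have hε0 : 0 ≤ ε := (abs_nonneg _).trans (hxT 0 (by positivity)).2.le
  have hR : (b - a) / γ = 2 ^ (k + 1) / τ := by
    rw [hγdef, pow_succ]; field_simp
  rw [hR, div_pow, ← pow_mul, ← mul_div_assoc, le_div_iff₀ (by positivity)] at hmain
  have h1 : (L + 1) * 3 ^ k * ε * 2 ^ ((k + 1) * k) ≤ (L + 1) * 3 ^ D * ε * 2 ^ ((D + 1) * D) := by
    gcongr <;> norm_num
  have hρ0 : 0 ≤ ρ := by
    have h2 : 0 ≤ (L + 1) * 3 ^ D * 2 ^ ((D + 1) * D) * ε := by positivity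
    by_contra! h
    have := mul_neg_of_neg_of_pos h (pow_pos hτ D)
    linarith
  have h3 : ρ * τ ^ D ≤ |F 0 y| * τ ^ k :=
    mul_le_mul hyρ (pow_le_pow_of_le_one hτ.le hτ1 hkD) (by positivity) (by positivity)
  linarith

open Set in
/-- An analytic function on `ℝ` all of whose derivatives vanish at a point is zero. -/
theorem eq_zero_of_iteratedDeriv_eq_zero {f : ℝ → ℝ} (hf : AnalyticOnNhd ℝ f univ) (x₀ : ℝ)
    (h : ∀ k, iteratedDeriv k f x₀ = 0) : f = 0 := by
  have htop : analyticOrderAt f x₀ = ⊤ := by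
    refine ENat.eq_top_iff_forall_ge.2 fun n => ?_
    exact (natCast_le_analyticOrderAt_iff_iteratedDeriv_eq_zero (hf x₀ trivial)).2
      fun i _ => h i
  rw [analyticOrderAt_eq_top] at htop
  exact hf.eq_of_eventuallyEq (g := 0) (fun _ _ => analyticAt_const) htop

/-- Near each point, a compact family of nonzero linear combinations of linearly independent
analytic functions has uniformly pinched derivatives. -/
theorem exists_pinched_deriv {N : ℕ} (e : Fin N → ℝ → ℝ)
    (he : ∀ i, AnalyticOnNhd ℝ (e i) Set.univ) (hli : LinearIndependent ℝ e) (x₀ : ℝ)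
    {s : Set (Fin N → ℝ)} (hs : IsCompact s) (hs0 : (0 : Fin N → ℝ) ∉ s) :
    ∃ δ > 0, ∃ D : ℕ, ∃ L : ℝ, 0 ≤ L ∧ ∀ c ∈ s, ∃ k ≤ D, ∃ A > 0,
      ∀ x ∈ Set.Icc (x₀ - δ) (x₀ + δ), A ≤ |∑ i, c i * iteratedDeriv k (e i) x| ∧
        |∑ i, c i * iteratedDeriv k (e i) x| ≤ L * A := by
  refine hs.induction_on (p := fun t => ∃ δ > 0, ∃ D : ℕ, ∃ L : ℝ, 0 ≤ L ∧ ∀ c ∈ t,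
    ∃ k ≤ D, ∃ A > 0,
    ∀ x ∈ Set.Icc (x₀ - δ) (x₀ + δ), A ≤ |∑ i, c i * iteratedDeriv k (e i) x| ∧
      |∑ i, c i * iteratedDeriv k (e i) x| ≤ L * A) ?_ ?_ ?_ ?_
  · exact ⟨1, one_pos, 0, 0, le_rfl, by simp⟩
  · rintro t u htu ⟨δ, hδ, D, L, hL, h⟩
    exact ⟨δ, hδ, D, L, hL, fun c hc => h c (htu hc)⟩
  · rintro t u ⟨δ, hδ, D, L, hL, h⟩ ⟨δ', hδ', D', L', hL', h'⟩
    refine ⟨min δ δ', lt_min hδ hδ', max D D', max L L', hL.trans (le_max_left _ _), ?_⟩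
    rintro c (hc | hc)
    · obtain ⟨k, hk, A, hA, hx⟩ := h c hc
      refine ⟨k, hk.trans (le_max_left _ _), A, hA, fun x hxm => ?_⟩
      have hm := min_le_left δ δ'
      have := hx x ⟨by linarith [hxm.1], by linarith [hxm.2]⟩
      exact ⟨this.1, this.2.trans (by gcongr; exact le_max_left _ _)⟩
    · obtain ⟨k, hk, A, hA, hx⟩ := h' c hc
      refine ⟨k, hk.trans (le_max_right _ _), A, hA, fun x hxm => ?_⟩
      have hm := min_le_right δ δ'
      have := hx x ⟨by linarith [hxm.1], by linarith [hxm.2]⟩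
      exact ⟨this.1, this.2.trans (by gcongr; exact le_max_right _ _)⟩
  · intro c hc
    have hk : ∃ k, ∑ i, c i * iteratedDeriv k (e i) x₀ ≠ 0 := by
      by_contra! hzero
      have han : AnalyticOnNhd ℝ (fun x => ∑ i, c i * e i x) Set.univ :=
        fun x _ => Finset.analyticAt_fun_sum _ fun i _ => analyticAt_const.mul (he i x trivial)
      have h0 := eq_zero_of_iteratedDeriv_eq_zero han x₀ fun k => by
        rw [iteratedDeriv_fun_sum fun i _ =>
          (contDiff_const.mul (he i).contDiff).contDiffAt, ← hzero k]
        exact Finset.sum_congr rfl fun i _ => iteratedDeriv_const_mul_field _ _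
      refine hs0 ?_
      have : c = 0 := by
        funext i
        refine Fintype.linearIndependent_iff.1 hli c ?_ i
        funext x
        simpa using congrFun h0 x
      rwa [← this]
    obtain ⟨k, hk⟩ := hk
    have hcont : Continuous fun p : (Fin N → ℝ) × ℝ =>
        |∑ i, p.1 i * iteratedDeriv k (e i) p.2| := by
      have : ∀ i, Continuous (iteratedDeriv k (e i)) := fun i =>
        ((he i).contDiff (n := k)).continuous_iteratedDeriv k le_rfl
      fun_prop
    have hpos := abs_pos.2 hk
    have hev := (hcont.tendsto (c, x₀)).eventually
      (Ioo_mem_nhds (a := |∑ i, c i * iteratedDeriv k (e i) x₀| / 2)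
        (b := 2 * |∑ i, c i * iteratedDeriv k (e i) x₀|)
        (show _ < |∑ i, c i * iteratedDeriv k (e i) x₀| by linarith)
        (show |∑ i, c i * iteratedDeriv k (e i) x₀| < _ by linarith))
    rw [nhds_prod_eq, Filter.eventually_prod_iff] at hev
    obtain ⟨pa, hpa, pb, hpb, hab⟩ := hev
    obtain ⟨δ, hδ, hball⟩ := Metric.nhds_basis_closedBall.eventually_iff.1 hpb
    rw [Real.closedBall_eq_Icc] at hball
    refine ⟨{c | pa c}, mem_nhdsWithin_of_mem_nhds hpa, δ, hδ, k, 4, by norm_num,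
      fun c' hc' => ⟨k, le_rfl, _, half_pos hpos, fun x hx => ?_⟩⟩
    have := hab hc' (hball hx)
    exact ⟨this.1.le, this.2.le.trans (by linarith)⟩

/-- Uniform sublevel set estimates near a point for the span of finitely many analytic
functions. -/
theorem exists_uniform_sublevel {ι : Type*} [Finite ι] (e : ι → ℝ → ℝ)
    (he : ∀ i, AnalyticOnNhd ℝ (e i) Set.univ) (x₀ : ℝ) :
    ∃ δ > 0, ∃ D : ℕ, ∃ C > 0, ∀ F ∈ Submodule.span ℝ (Set.range e), ∀ a b : ℝ, x₀ - δ ≤ a →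
      a < b → b ≤ x₀ + δ → ∀ ε ρ τ : ℝ, 0 < τ → τ ≤ 1 → C * ε < ρ * τ ^ D →
        (∃ y ∈ Set.Icc a b, ρ ≤ |F y|) →
        volume {x | x ∈ Set.Ioo a b ∧ |F x| < ε} ≤ ENNReal.ofReal (τ * (b - a)) := by
  classical
  set E := Submodule.span ℝ (Set.range e) with hE
  have : FiniteDimensional ℝ E := FiniteDimensional.span_of_finite ℝ (Set.finite_range e)
  have hEan : ∀ F ∈ E, AnalyticOnNhd ℝ F Set.univ := by
    intro F hF
    refine Submodule.span_induction ?_ ?_ ?_ ?_ hF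
    · rintro _ ⟨i, rfl⟩; exact he i
    · exact fun _ _ => analyticAt_const
    · exact fun x y _ _ hx hy => hx.add hy
    · exact fun a x _ hx y hy => (analyticAt_const (v := a)).smul (hx y hy)
  let v := Module.finBasis ℝ E
  set N := Module.finrank ℝ E
  let e' : Fin N → ℝ → ℝ := fun i => (v i : ℝ → ℝ)
  have he' : ∀ i, AnalyticOnNhd ℝ (e' i) Set.univ := fun i => hEan _ (v i).2
  have hli : LinearIndependent ℝ e' :=
    v.linearIndependent.map' E.subtype (Submodule.ker_subtype _)
  obtain ⟨δ, hδ, D, L, hL, hpin⟩ := exists_pinched_deriv e' he' hli x₀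
    (isCompact_sphere (0 : Fin N → ℝ) 1) (by simp)
  refine ⟨δ, hδ, D, (L + 1) * 3 ^ D * 2 ^ ((D + 1) * D), by positivity, ?_⟩
  intro F hF a b ha hab hb ε ρ τ hτ hτ1 hε hρ
  set c : Fin N → ℝ := fun i => v.repr ⟨F, hF⟩ i with hc
  have hFc : F = fun x => ∑ i, c i * e' i x := by
    have := congrArg Subtype.val (v.sum_repr ⟨F, hF⟩)
    funext x
    refine (congrFun this x).symm.trans ?_
    simp [e', c, -Module.Basis.sum_repr]
  by_cases hc0 : c = 0
  · obtain ⟨y, hy, hyρ⟩ := hρ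
    have hF0 : ∀ x, F x = 0 := fun x => by rw [hFc, hc0]; simp
    have hε0 : ε ≤ 0 := by
      by_contra! h
      have h1 : 0 < (L + 1) * 3 ^ D * 2 ^ ((D + 1) * D) * ε := by positivity
      have h2 : ρ ≤ 0 := by simpa [hF0 y] using hyρ
      have h3 := mul_nonpos_of_nonpos_of_nonneg h2 (pow_pos hτ D).le
      linarith
    have : {x | x ∈ Set.Ioo a b ∧ |F x| < ε} = ∅ := by
      ext x; simp [hF0, hε0]
    rw [this]; simp
  have hcn : 0 < ‖c‖ := norm_pos_iff.2 hc0
  obtain ⟨k, hk, A, hA, hx⟩ := hpin (‖c‖⁻¹ • c) (by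
    simp [norm_smul, hcn.ne'])
  let G : ℕ → ℝ → ℝ := fun k x => ∑ i, c i * iteratedDeriv k (e' i) x
  have hG0 : G 0 = F := by rw [hFc]; simp [G]
  have hGk : ∀ x, |∑ i, (‖c‖⁻¹ • c) i * iteratedDeriv k (e' i) x| = ‖c‖⁻¹ * |G k x| := by
    intro x
    simp only [Pi.smul_apply, smul_eq_mul, mul_assoc, ← Finset.mul_sum, abs_mul, G]
    rw [abs_of_pos (inv_pos.2 hcn)]
  have hd : ∀ i y, HasDerivAt (G i) (G (i + 1) y) y := by
    intro i y
    refine HasDerivAt.fun_sum fun j _ => HasDerivAt.const_mul _ ?_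
    rw [iteratedDeriv_succ]
    exact (((he' j).contDiff (n := (i + 1 : ℕ))).differentiable_iteratedDeriv i
      (by exact_mod_cast Nat.lt_succ_self i) y).hasDerivAt
  rw [← hG0] at hρ ⊢
  refine volume_sublevel_le hL (c := ‖c‖ * A) (by positivity) hab hk G hd ?_ hτ hτ1 hε hρ
  intro y hy
  have := hx y ⟨ha.trans hy.1, hy.2.trans hb⟩
  rw [hGk, inv_mul_eq_div, le_div_iff₀ hcn, div_le_iff₀ hcn] at this
  exact ⟨by linarith [this.1], by linarith [this.2]⟩

/-- One-dimensional Besicovitch-type covering bound for finitely many intervals. -/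
theorem volume_inter_biUnion_Ioo_le {a b κ : ℝ} (hκ : 0 ≤ κ) (Z : Set ℝ) (n : ℕ) :
    ∀ (T : Finset (ℝ × ℝ)) (_ : T.card = n) (_ : ∀ p ∈ T, a ≤ p.1 ∧ p.1 ≤ p.2 ∧ p.2 ≤ b)
      (_ : ∀ p ∈ T, volume (Z ∩ Set.Ioo p.1 p.2) ≤ ENNReal.ofReal (κ * (p.2 - p.1))),
      volume (Z ∩ ⋃ p ∈ T, Set.Ioo p.1 p.2) ≤ ENNReal.ofReal (2 * κ * (b - a)) := by
  classical
  induction n with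
  | zero =>
    intro T hT _ _
    rw [Finset.card_eq_zero] at hT
    simp [hT]
  | succ n ih =>
    intro T hT hsub hvol
    by_cases hred : ∃ p ∈ T, Set.Ioo p.1 p.2 ⊆ ⋃ q ∈ T.erase p, Set.Ioo q.1 q.2
    · obtain ⟨p, hp, hpsub⟩ := hred
      have := ih (T.erase p) (by rw [Finset.card_erase_of_mem hp, hT]; rfl)
        (fun q hq => hsub q (Finset.mem_of_mem_erase hq))
        (fun q hq => hvol q (Finset.mem_of_mem_erase hq))
      refine (measure_mono (Set.inter_subset_inter_right _ ?_)).trans this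
      refine Set.iUnion₂_subset fun q hq => ?_
      by_cases hqp : q = p
      · rwa [hqp]
      · exact Set.subset_biUnion_of_mem (u := fun q : ℝ × ℝ => Set.Ioo q.1 q.2)
          (Finset.mem_coe.2 (Finset.mem_erase.2 ⟨hqp, hq⟩))
    · push Not at hred
      have hmult : ∀ x, (T.filter fun p => x ∈ Set.Ioo p.1 p.2).card ≤ 2 := by
        intro x
        by_contra! hcard
        set U := T.filter fun p => x ∈ Set.Ioo p.1 p.2 with hU
        have hne : U.Nonempty := Finset.card_pos.1 (by omega)
        obtain ⟨p, hp, hpmin⟩ := U.exists_min_image (fun p => p.1) hne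
        obtain ⟨q, hq, hqmax⟩ := U.exists_max_image (fun p => p.2) hne
        obtain ⟨r, hr, hrpq⟩ := Finset.exists_mem_notMem_of_card_lt_card
          (show ({p, q} : Finset (ℝ × ℝ)).card < U.card from
            (Finset.card_le_two).trans_lt hcard)
        simp only [Finset.mem_insert, Finset.mem_singleton, not_or] at hrpq
        have hrU := Finset.mem_filter.1 hr
        have hpU := Finset.mem_filter.1 hp
        have hqU := Finset.mem_filter.1 hq
        refine hred r hrU.1 fun y hy => ?_
        have h1 := hpmin r hr
        have h2 := hqmax r hr
        simp only [Set.mem_iUnion]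
        rcases le_or_gt y x with hyx | hyx
        · exact ⟨p, Finset.mem_erase.2 ⟨fun h => hrpq.1 h.symm, hpU.1⟩,
            h1.trans_lt hy.1, hyx.trans_lt hpU.2.2⟩
        · exact ⟨q, Finset.mem_erase.2 ⟨fun h => hrpq.2 h.symm, hqU.1⟩,
            hqU.2.1.trans hyx, hy.2.trans_le h2⟩
      have hlen : ∑ p ∈ T, volume (Set.Ioo p.1 p.2) ≤ 2 * volume (Set.Ioo a b) := by
        calc ∑ p ∈ T, volume (Set.Ioo p.1 p.2)
            = ∑ p ∈ T, ∫⁻ x, (Set.Ioo p.1 p.2).indicator 1 x := by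
              simp [measurableSet_Ioo]
          _ = ∫⁻ x, ∑ p ∈ T, (Set.Ioo p.1 p.2).indicator 1 x :=
              (lintegral_finsetSum _ fun p _ => measurable_one.indicator measurableSet_Ioo).symm
          _ ≤ ∫⁻ x, 2 * (Set.Ioo a b).indicator 1 x := by
              refine lintegral_mono fun x => ?_
              by_cases hx : x ∈ Set.Ioo a b
              · simp only [Set.indicator_apply, hx, if_true, Pi.one_apply, mul_one,
                  ← Finset.sum_filter, Finset.sum_const, nsmul_eq_mul]
                exact_mod_cast hmult x
              · refine le_of_eq_of_le (Finset.sum_eq_zero fun p hp => ?_) zero_le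
                refine Set.indicator_of_notMem (fun hxp => hx ?_) _
                have := hsub p hp
                exact ⟨this.1.trans_lt hxp.1, hxp.2.trans_le this.2.2⟩
          _ = 2 * volume (Set.Ioo a b) := by
              rw [lintegral_const_mul _ (measurable_one.indicator measurableSet_Ioo),
                lintegral_indicator_one measurableSet_Ioo]
      calc volume (Z ∩ ⋃ p ∈ T, Set.Ioo p.1 p.2)
          ≤ ∑ p ∈ T, volume (Z ∩ Set.Ioo p.1 p.2) := by
            rw [Set.inter_iUnion₂]; exact measure_biUnion_finset_le _ _
        _ ≤ ∑ p ∈ T, ENNReal.ofReal κ * volume (Set.Ioo p.1 p.2) := by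
            refine Finset.sum_le_sum fun p hp => (hvol p hp).trans ?_
            rw [Real.volume_Ioo, ENNReal.ofReal_mul hκ]
        _ ≤ ENNReal.ofReal κ * (2 * volume (Set.Ioo a b)) := by
            rw [← Finset.mul_sum]; gcongr
        _ = ENNReal.ofReal (2 * κ * (b - a)) := by
            rw [Real.volume_Ioo, mul_comm (2 : ℝ) κ, mul_assoc, ENNReal.ofReal_mul hκ,
              ENNReal.ofReal_mul (by norm_num)]
            simp

/-- If each point of `Z` lies in an interval in which `Z` has relative measure at most `κ`,
then `Z` has measure at most `2 κ (b - a)`. -/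
theorem volume_le_of_local_density {a b κ : ℝ} (hκ : 0 ≤ κ) (Z : Set ℝ)
    (hZ : ∀ x ∈ Z, ∃ l r : ℝ, a ≤ l ∧ l < x ∧ x < r ∧ r ≤ b ∧
      volume (Z ∩ Set.Ioo l r) ≤ ENNReal.ofReal (κ * (r - l))) :
    volume Z ≤ ENNReal.ofReal (2 * κ * (b - a)) := by
  classical
  choose! l r hl hlx hxr hr hv using hZ
  obtain ⟨T, hTZ, hTc, hTU⟩ := TopologicalSpace.isOpen_biUnion_countable Z
    (fun x => Set.Ioo (l x) (r x)) fun x _ => isOpen_Ioo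
  have hcover : Z ⊆ ⋃ x ∈ T, Set.Ioo (l x) (r x) := by
    rw [hTU]
    exact fun x hx => Set.mem_biUnion hx ⟨hlx x hx, hxr x hx⟩
  rcases T.eq_empty_or_nonempty with hT | hT
  · have : Z = ∅ := by simpa [hT] using hcover
    simp [this]
  obtain ⟨g, hg⟩ := hTc.exists_eq_range hT
  have hgZ : ∀ i, g i ∈ Z := fun i => hTZ (hg ▸ Set.mem_range_self i)
  let W : ℕ → Set ℝ := fun n => Z ∩ ⋃ p ∈ (Finset.range n).image (fun i => (l (g i), r (g i))),
    Set.Ioo p.1 p.2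
  have hW : Z ⊆ ⋃ n, W n := by
    intro x hx
    have := hcover hx
    rw [hg] at this
    simp only [Set.mem_iUnion, Set.mem_range, exists_prop] at this
    obtain ⟨_, ⟨i, rfl⟩, hi⟩ := this
    refine Set.mem_iUnion.2 ⟨i + 1, hx, ?_⟩
    exact Set.mem_biUnion (x := (l (g i), r (g i))) (by
      simp only [Finset.coe_image, Finset.coe_range]
      exact ⟨i, by simp, rfl⟩) hi
  have hmono : Monotone W := by
    intro m n hmn
    refine Set.inter_subset_inter_right _ (Set.biUnion_subset_biUnion_left ?_)
    exact Finset.coe_subset.2 (Finset.image_subset_image (Finset.range_mono hmn))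
  refine (measure_mono hW).trans ?_
  rw [hmono.measure_iUnion]
  refine iSup_le fun n => volume_inter_biUnion_Ioo_le hκ Z _ _ rfl ?_ ?_
  · intro p hp
    obtain ⟨i, -, rfl⟩ := Finset.mem_image.1 hp
    exact ⟨hl _ (hgZ i), ((hlx _ (hgZ i)).trans (hxr _ (hgZ i))).le, hr _ (hgZ i)⟩
  · intro p hp
    obtain ⟨i, -, rfl⟩ := Finset.mem_image.1 hp
    exact hv _ (hgZ i)

/-- The maximal interval around `x` inside `(a, b)` on which `ψ < ρ`. -/
theorem exists_maximal_Ioo_lt {ψ : ℝ → ℝ} (hψ : Continuous ψ) {ρ a b x : ℝ}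
    (hx : x ∈ Set.Ioo a b) (hxρ : ψ x < ρ) (hab : ∃ z ∈ Set.Icc a b, ρ ≤ ψ z) :
    ∃ l r : ℝ, a ≤ l ∧ l < x ∧ x < r ∧ r ≤ b ∧ (∀ y ∈ Set.Ioo l r, ψ y < ρ) ∧
      (l = a ∨ ρ ≤ ψ l) ∧ (r = b ∨ ρ ≤ ψ r) ∧ ∃ z ∈ Set.Icc l r, ρ ≤ ψ z := by
  have hl : ∃ l, a ≤ l ∧ l < x ∧ (∀ y ∈ Set.Ioc l x, ψ y < ρ) ∧ (l = a ∨ ρ ≤ ψ l) := by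
    let A : Set ℝ := {y | y ∈ Set.Icc a x ∧ ρ ≤ ψ y}
    have hAcl : IsCompact A :=
      isCompact_Icc.inter_right (isClosed_le continuous_const hψ)
    rcases A.eq_empty_or_nonempty with hA | hA
    · refine ⟨a, le_rfl, hx.1, fun y hy => ?_, Or.inl rfl⟩
      by_contra! h
      exact Set.notMem_empty y (hA ▸ (⟨⟨hy.1.le, hy.2⟩, h⟩ : y ∈ A))
    · obtain ⟨l, hl, hmax⟩ := hAcl.exists_isGreatest hA
      refine ⟨l, hl.1.1, lt_of_le_of_ne hl.1.2 ?_, fun y hy => ?_, Or.inr hl.2⟩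
      · rintro rfl; exact absurd hl.2 (not_le.2 hxρ)
      · by_contra! h
        exact absurd (hmax ⟨⟨hl.1.1.trans hy.1.le, hy.2⟩, h⟩) (not_le.2 hy.1)
  have hr : ∃ r, x < r ∧ r ≤ b ∧ (∀ y ∈ Set.Ico x r, ψ y < ρ) ∧ (r = b ∨ ρ ≤ ψ r) := by
    let A : Set ℝ := {y | y ∈ Set.Icc x b ∧ ρ ≤ ψ y}
    have hAcl : IsCompact A :=
      isCompact_Icc.inter_right (isClosed_le continuous_const hψ)
    rcases A.eq_empty_or_nonempty with hA | hA
    · refine ⟨b, hx.2, le_rfl, fun y hy => ?_, Or.inl rfl⟩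
      by_contra! h
      exact Set.notMem_empty y (hA ▸ (⟨⟨hy.1, hy.2.le⟩, h⟩ : y ∈ A))
    · obtain ⟨r, hr, hmin⟩ := hAcl.exists_isLeast hA
      refine ⟨r, lt_of_le_of_ne hr.1.1 ?_, hr.1.2, fun y hy => ?_, Or.inr hr.2⟩
      · rintro rfl; exact absurd hr.2 (not_le.2 hxρ)
      · by_contra! h
        exact absurd (hmin ⟨⟨hy.1, hy.2.le.trans hr.1.2⟩, h⟩) (not_le.2 hy.2)
  obtain ⟨l, hal, hlx, hl, hl'⟩ := hl
  obtain ⟨r, hxr, hrb, hr, hr'⟩ := hr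
  have hlr : ∀ y ∈ Set.Ioo l r, ψ y < ρ := fun y hy => by
    rcases le_total y x with h | h
    · exact hl y ⟨hy.1, h⟩
    · exact hr y ⟨h, hy.2⟩
  refine ⟨l, r, hal, hlx, hxr, hrb, hlr, hl', hr', ?_⟩
  rcases hl' with rfl | h
  · rcases hr' with rfl | h
    · exact hab
    · exact ⟨r, ⟨(hlx.trans hxr).le, le_rfl⟩, h⟩
  · exact ⟨l, ⟨le_rfl, (hlx.trans hxr).le⟩, h⟩

/-- Among finitely many functions, one can find an interval around `x` on which one of them is
smaller than `ρ`, while each of them reaches `ρ` on its closure. -/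
theorem exists_common_maximal_Ioo {α : Type*} {ψ : α → ℝ → ℝ} (hψ : ∀ s, Continuous (ψ s))
    {S : Finset α} {ρ a b x : ℝ} (hx : x ∈ Set.Ioo a b)
    (hab : ∀ s ∈ S, ∃ z ∈ Set.Icc a b, ρ ≤ ψ s z) (hxρ : ∃ s ∈ S, ψ s x < ρ) :
    ∃ s ∈ S, ∃ l r : ℝ, a ≤ l ∧ l < x ∧ x < r ∧ r ≤ b ∧ (∀ y ∈ Set.Ioo l r, ψ s y < ρ) ∧
      ∀ t ∈ S, ∃ z ∈ Set.Icc l r, ρ ≤ ψ t z := by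
  classical
  have hmax : ∀ s, ∃ l r : ℝ, s ∈ S → ψ s x < ρ → a ≤ l ∧ l < x ∧ x < r ∧ r ≤ b ∧
      (∀ y ∈ Set.Ioo l r, ψ s y < ρ) ∧
      (l = a ∨ ρ ≤ ψ s l) ∧ (r = b ∨ ρ ≤ ψ s r) ∧ ∃ z ∈ Set.Icc l r, ρ ≤ ψ s z := by
    intro s
    by_cases h : s ∈ S ∧ ψ s x < ρ
    · obtain ⟨l, r, hlr⟩ := exists_maximal_Ioo_lt (hψ s) hx h.2 (hab s h.1)
      exact ⟨l, r, fun _ _ => hlr⟩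
    · exact ⟨0, 0, fun h1 h2 => absurd ⟨h1, h2⟩ h⟩
  choose l r hlr using hmax
  obtain ⟨s₀, hs₀, hs₀x⟩ := hxρ
  obtain ⟨s, hs, hsmax⟩ := (S.filter fun s => ψ s x < ρ).exists_max_image
    (fun s => r s - l s) ⟨s₀, Finset.mem_filter.2 ⟨hs₀, hs₀x⟩⟩
  rw [Finset.mem_filter] at hs
  obtain ⟨h1, h2, h3, h4, h5, -, -, -⟩ := hlr s hs.1 hs.2
  refine ⟨s, hs.1, l s, r s, h1, h2, h3, h4, h5, fun t ht => ?_⟩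
  by_contra! hcon
  have htx := hcon x ⟨h2.le, h3.le⟩
  obtain ⟨g1, g2, g3, g4, -, g6, g7, z, hz, hzρ⟩ := hlr t ht htx
  have hlt : l t ≤ l s := by
    by_contra! h
    rcases g6 with g | g
    · linarith
    · exact absurd (hcon (l t) ⟨h.le, by linarith⟩) (not_lt.2 g)
  have hrt : r s ≤ r t := by
    by_contra! h
    rcases g7 with g | g
    · linarith
    · exact absurd (hcon (r t) ⟨by linarith, h.le⟩) (not_lt.2 g)
  have := hsmax t (Finset.mem_filter.2 ⟨ht, htx⟩)
  exact absurd (hcon z ⟨by linarith [hz.1], by linarith [hz.2]⟩) (not_lt.2 hzρ)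

/-- `x` is marked with respect to `S` if there is a clique of elements of `S` whose values at `x`
lie in `[ε, ρ]`, such that all other elements of `S` related to all of the clique have values at
least `ρ`. -/
def IsMarked {α : Type*} (R : α → α → Prop) (ψ : α → ℝ → ℝ) (ε ρ : ℝ) (S : Finset α)
    (x : ℝ) : Prop :=
  ∃ F ⊆ S, (∀ s ∈ F, ∀ t ∈ F, R s t) ∧ (∀ s ∈ F, ε ≤ ψ s x ∧ ψ s x ≤ ρ) ∧
    ∀ s ∈ S, s ∉ F → (∀ t ∈ F, R s t) → ρ ≤ ψ s x

/-- Abstract quantitative nondivergence: unmarked points are rare. -/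
theorem volume_not_isMarked_le {α : Type*} {R : α → α → Prop} (hRr : ∀ s, R s s)
    (hRs : ∀ s t, R s t → R t s)
    {ψ : α → ℝ → ℝ} (hψ : ∀ s, Continuous (ψ s)) {ε ρ τ A B : ℝ} (hτ : 0 ≤ τ) (S₀ : Finset α)
    (hgood : ∀ s ∈ S₀, ∀ a b, A ≤ a → a < b → b ≤ B → (∃ z ∈ Set.Icc a b, ρ ≤ ψ s z) →
      volume {x | x ∈ Set.Ioo a b ∧ ψ s x < ε} ≤ ENNReal.ofReal (τ * (b - a))) (k : ℕ) :
    ∀ S ⊆ S₀, (∀ F ⊆ S, (∀ s ∈ F, ∀ t ∈ F, R s t) → F.card ≤ k) →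
      ∀ a b, A ≤ a → a < b → b ≤ B → (∀ s ∈ S, ∃ z ∈ Set.Icc a b, ρ ≤ ψ s z) →
      volume {x | x ∈ Set.Ioo a b ∧ ¬ IsMarked R ψ ε ρ S x} ≤
        ENNReal.ofReal ((4 ^ k - 1) * τ * (b - a)) := by
  classical
  induction k with
  | zero =>
    intro S hS hcl a b _ _ _ _
    have hS0 : S = ∅ := by
      by_contra hne
      obtain ⟨s, hs⟩ := Finset.nonempty_iff_ne_empty.2 hne
      have := hcl {s} (Finset.singleton_subset_iff.2 hs) (by simp [hRr])
      simp at this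
    have : {x | x ∈ Set.Ioo a b ∧ ¬ IsMarked R ψ ε ρ S x} = ∅ := by
      ext x
      simp only [Set.mem_ofPred_eq, Set.mem_empty_iff_false, iff_false, not_and, not_not]
      exact fun _ => ⟨∅, by simp, by simp, by simp, by simp [hS0]⟩
    rw [this]; simp
  | succ k ih =>
    intro S hS hcl a b ha hab hb hsup
    have h4 : (1 : ℝ) ≤ 4 ^ k := one_le_pow₀ (by norm_num)
    have hmain := volume_le_of_local_density (a := a) (b := b) (κ := 4 ^ k * τ) (by positivity)
      {x | x ∈ Set.Ioo a b ∧ ¬ IsMarked R ψ ε ρ S x} ?_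
    · refine hmain.trans (ENNReal.ofReal_le_ofReal ?_)
      have : 2 * (4 ^ k * τ) ≤ (4 ^ (k + 1) - 1) * τ := by
        rw [pow_succ]; nlinarith
      exact mul_le_mul_of_nonneg_right this (by linarith)
    rintro x ⟨hx, hxm⟩
    have hlow : ∃ s ∈ S, ψ s x < ρ := by
      by_contra! h
      exact hxm ⟨∅, by simp, by simp, by simp, fun s hs _ _ => h s hs⟩
    obtain ⟨s, hs, l, r, hal, hlx, hxr, hrb, hlt, hsupt⟩ :=
      exists_common_maximal_Ioo hψ hx hsup hlow
    refine ⟨l, r, hal, hlx, hxr, hrb, ?_⟩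
    set S' := S.filter fun t => t ≠ s ∧ R s t with hS'
    have hS'S : S' ⊆ S := Finset.filter_subset _ _
    have hih := ih S' (hS'S.trans hS) (by
        intro F hF hFcl
        have hsF : s ∉ F := fun h => (Finset.mem_filter.1 (hF h)).2.1 rfl
        have := hcl (insert s F) (Finset.insert_subset hs (hF.trans hS'S)) (by
          intro p hp q hq
          rw [Finset.mem_insert] at hp hq
          rcases hp with rfl | hp <;> rcases hq with rfl | hq
          · exact hRr _
          · exact (Finset.mem_filter.1 (hF hq)).2.2
          · exact hRs _ _ (Finset.mem_filter.1 (hF hp)).2.2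
          · exact hFcl p hp q hq)
        rw [Finset.card_insert_of_notMem hsF] at this
        omega) l r (ha.trans hal) (hlx.trans hxr) (hrb.trans hb)
        (fun t ht => hsupt t (hS'S ht))
    have hg := hgood s (hS hs) l r (ha.trans hal) (hlx.trans hxr) (hrb.trans hb) (hsupt s hs)
    have hsub : {x | x ∈ Set.Ioo a b ∧ ¬ IsMarked R ψ ε ρ S x} ∩ Set.Ioo l r ⊆
        {x | x ∈ Set.Ioo l r ∧ ¬ IsMarked R ψ ε ρ S' x} ∪
          {x | x ∈ Set.Ioo l r ∧ ψ s x < ε} := by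
      rintro y ⟨⟨-, hym⟩, hy⟩
      by_contra hcon
      simp only [Set.mem_union, Set.mem_ofPred_eq, hy, true_and, not_or, not_not, not_lt] at hcon
      obtain ⟨⟨F, hF, hFcl, hFv, hFm⟩, hεs⟩ := hcon
      refine hym ⟨insert s F, Finset.insert_subset hs (hF.trans hS'S), ?_, ?_, ?_⟩
      · intro p hp q hq
        rw [Finset.mem_insert] at hp hq
        rcases hp with rfl | hp <;> rcases hq with rfl | hq
        · exact hRr _
        · exact (Finset.mem_filter.1 (hF hq)).2.2
        · exact hRs _ _ (Finset.mem_filter.1 (hF hp)).2.2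
        · exact hFcl p hp q hq
      · intro t ht
        rcases Finset.mem_insert.1 ht with rfl | ht
        · exact ⟨hεs, (hlt y hy).le⟩
        · exact hFv t ht
      · intro t ht htF htR
        rw [Finset.mem_insert, not_or] at htF
        exact hFm t (Finset.mem_filter.2 ⟨ht, htF.1,
          hRs _ _ (htR s (Finset.mem_insert_self _ _))⟩) htF.2
          fun q hq => htR q (Finset.mem_insert_of_mem hq)
    refine (measure_mono hsub).trans ((measure_union_le _ _).trans ((add_le_add hih hg).trans ?_))
    have hlr : 0 ≤ r - l := by linarith
    rw [← ENNReal.ofReal_add (mul_nonneg (mul_nonneg (by linarith) hτ) hlr)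
      (mul_nonneg hτ hlr)]
    exact ENNReal.ofReal_le_ofReal (le_of_eq (by ring))

open scoped RealInnerProductSpace

/-- Adjoining a vector multiplies the Gram determinant by the squared distance to the span. -/
theorem det_gram_sumElim {E ι : Type*} [NormedAddCommGroup E] [InnerProductSpace ℝ E] [Fintype ι]
    [DecidableEq ι] (b : ι → E) (v w : E)
    (hvw : v - w ∈ Submodule.span ℝ (Set.range b)) (hw : w ∈ (Submodule.span ℝ (Set.range b))ᗮ) :
    (Matrix.gram ℝ (Sum.elim b fun _ : Unit => v)).det = (Matrix.gram ℝ b).det * ‖w‖ ^ 2 := by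
  obtain ⟨c, hc⟩ := (Submodule.mem_span_range_iff_exists_fun ℝ).1 hvw
  have hv : v = ∑ i, c i • b i + w := by rw [hc]; abel
  have hbw : ∀ i, ⟪b i, w⟫ = 0 := fun i =>
    hw (b i) (Submodule.subset_span (Set.mem_range_self i))
  have hwb : ∀ i, ⟪w, b i⟫ = 0 := fun i => by rw [real_inner_comm, hbw]
  let U : Matrix (ι ⊕ Unit) (ι ⊕ Unit) ℝ := Matrix.fromBlocks 1 (Matrix.of fun i _ => c i) 0 1
  have hU : U.det = 1 := by simp [U]
  have hmul : Matrix.gram ℝ (Sum.elim b fun _ : Unit => v) = U.transpose *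
      Matrix.fromBlocks (Matrix.gram ℝ b) 0 0 (Matrix.of fun _ _ => ‖w‖ ^ 2) * U := by
    simp only [U, Matrix.fromBlocks_transpose, Matrix.fromBlocks_multiply]
    have e1 : ∀ i, ⟪b i, v⟫ = ∑ j, ⟪b i, b j⟫ * c j := by
      intro i
      rw [hv, inner_add_right, hbw, inner_sum, add_zero]
      exact Finset.sum_congr rfl fun j _ => by rw [inner_smul_right]; ring
    have e2 : ∀ i, ⟪v, b i⟫ = ∑ j, c j * ⟪b j, b i⟫ := by
      intro i
      rw [real_inner_comm, e1]
      exact Finset.sum_congr rfl fun j _ => by rw [real_inner_comm]; ring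
    have e4 : ⟪v, w⟫ = ‖w‖ ^ 2 := by
      rw [hv, inner_add_left, sum_inner, real_inner_self_eq_norm_sq]
      simp [inner_smul_left, hbw]
    have e3 : ‖v‖ ^ 2 = ∑ j, (∑ i, c i * ⟪b i, b j⟫) * c j + ‖w‖ ^ 2 := by
      calc ‖v‖ ^ 2 = ⟪v, v⟫ := (real_inner_self_eq_norm_sq v).symm
        _ = ⟪v, ∑ i, c i • b i + w⟫ := by rw [← hv]
        _ = _ := by
          rw [inner_add_right, inner_sum, e4]
          congr 1
          exact Finset.sum_congr rfl fun j _ => by rw [inner_smul_right, e2]; ring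
    ext i j
    rcases i with i | i <;> rcases j with j | j
    · simp [Matrix.gram_apply]
    · simp [Matrix.gram_apply, Matrix.mul_apply, e1]
    · simp [Matrix.gram_apply, Matrix.mul_apply, e2]
    · simp [Matrix.gram_apply, Matrix.mul_apply, e3]
  rw [hmul, Matrix.det_mul, Matrix.det_mul, Matrix.det_transpose, hU,
    Matrix.det_fromBlocks_zero₂₁]
  simp

/-- The defining inequality for the covolume of a subspace enlarged by one vector. -/
theorem norm_proj_sup_span_le {E : Type*} [NormedAddCommGroup E] [InnerProductSpace ℝ E]
    [FiniteDimensional ℝ E] (V : Submodule ℝ E) {v : E} (hv : v ∉ V) (h : E) (β : ℝ) {S : ℝ}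
    (hS : 0 < S) :
    ‖Vᗮ.starProjection v‖ ^ 2 * (1 + S * ‖(V ⊔ Submodule.span ℝ {v})ᗮ.starProjection h‖ ^ 2) ≤
      (1 + S * ‖Vᗮ.starProjection h‖ ^ 2) * (‖β • h - v‖ ^ 2 + β ^ 2 / S) := by
  set w := Vᗮ.starProjection v with hw
  set h' := Vᗮ.starProjection h with hh'
  set V' := V ⊔ Submodule.span ℝ {v} with hV'
  have hw0 : w ≠ 0 := by
    intro h0
    rw [hw, Submodule.starProjection_apply_eq_zero_iff, Submodule.orthogonal_orthogonal] at h0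
    exact hv h0
  have hY : 0 < ‖w‖ ^ 2 := by positivity
  have hwV' : w ∈ V' := by
    rw [hw, Submodule.starProjection_orthogonal_val]
    exact sub_mem (Submodule.mem_sup_right (Submodule.mem_span_singleton_self v))
      (Submodule.mem_sup_left (Submodule.starProjection_apply_mem _ _))
  have hmin : ∀ t : ℝ, ‖V'ᗮ.starProjection h‖ ≤ ‖h' - t • w‖ := by
    intro t
    have hmem : V.starProjection h + t • w ∈ V' :=
      add_mem (Submodule.mem_sup_left (Submodule.starProjection_apply_mem _ _))
        (V'.smul_mem t hwV')
    rw [Submodule.starProjection_orthogonal_val, Submodule.starProjection_minimal]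
    refine (ciInf_le ⟨0, ?_⟩ (⟨_, hmem⟩ : V')).trans_eq ?_
    · rintro _ ⟨x, rfl⟩; exact norm_nonneg _
    · rw [hh', Submodule.starProjection_orthogonal_val, sub_sub]
  have hG : ‖V'ᗮ.starProjection h‖ ^ 2 * ‖w‖ ^ 2 ≤ ‖h'‖ ^ 2 * ‖w‖ ^ 2 - ⟪h', w⟫ ^ 2 := by
    have h1 := pow_le_pow_left₀ (norm_nonneg _) (hmin (⟪h', w⟫ / ‖w‖ ^ 2)) 2
    rw [norm_sub_sq_real, norm_smul, inner_smul_right, mul_pow, Real.norm_eq_abs, sq_abs] at h1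
    have h2 := mul_le_mul_of_nonneg_right h1 hY.le
    refine h2.trans_eq ?_
    field_simp
    ring
  have hβ : β ^ 2 * ‖h'‖ ^ 2 - 2 * β * ⟪h', w⟫ + ‖w‖ ^ 2 ≤ ‖β • h - v‖ ^ 2 := by
    have h1 : ‖β • h' - w‖ ≤ ‖β • h - v‖ := by
      rw [hh', hw, ← map_smul, ← map_sub]
      exact Submodule.norm_starProjection_apply_le _ _
    have h2 := pow_le_pow_left₀ (norm_nonneg _) h1 2
    rw [norm_sub_sq_real, norm_smul, inner_smul_left, mul_pow, Real.norm_eq_abs, sq_abs] at h2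
    simpa [mul_assoc] using h2
  set X := ‖h'‖ ^ 2
  set Y := ‖w‖ ^ 2
  set Z := ⟪h', w⟫
  have hX : 0 ≤ X := by positivity
  calc Y * (1 + S * ‖V'ᗮ.starProjection h‖ ^ 2)
      = Y + S * (‖V'ᗮ.starProjection h‖ ^ 2 * Y) := by ring
    _ ≤ Y + S * (X * Y - Z ^ 2) := by gcongr
    _ ≤ (1 + S * X) * ((β ^ 2 * X - 2 * β * Z + Y) + β ^ 2 / S) := by
        have : (1 + S * X) * ((β ^ 2 * X - 2 * β * Z + Y) + β ^ 2 / S) -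
          (Y + S * (X * Y - Z ^ 2)) = (β * (1 + S * X) - S * Z) ^ 2 / S := by
          field_simp; ring
        have h2 : 0 ≤ (β * (1 + S * X) - S * Z) ^ 2 / S := by positivity
        linarith
    _ ≤ _ := by gcongr

/-- An integer vector, seen in Euclidean space. -/
noncomputable def intVec {K : ℕ} (a : Fin K → ℤ) : EuclideanSpace ℝ (Fin K) :=
  WithLp.toLp 2 fun i => (a i : ℝ)

/-- Gram determinants of linearly independent integer families spanning `V`. -/
def gramDetSet {K : ℕ} (V : Submodule ℝ (EuclideanSpace ℝ (Fin K))) : Set ℝ :=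
  {n | ∃ (ι : Type) (_ : Fintype ι) (_ : DecidableEq ι) (b : ι → Fin K → ℤ),
    LinearIndependent ℝ (fun i => intVec (b i)) ∧
    Submodule.span ℝ (Set.range fun i => intVec (b i)) = V ∧
    n = (Matrix.gram ℝ fun i => intVec (b i)).det}

/-- The (squared) height of a rational subspace. -/
noncomputable def sqHeight {K : ℕ} (V : Submodule ℝ (EuclideanSpace ℝ (Fin K))) : ℝ :=
  sInf (gramDetSet V)

section height
variable {K : ℕ} {V : Submodule ℝ (EuclideanSpace ℝ (Fin K))}

theorem one_le_of_mem_gramDetSet {n : ℝ} (hn : n ∈ gramDetSet V) : 1 ≤ n := by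
  obtain ⟨ι, _, _, b, hli, -, rfl⟩ := hn
  have hpos : 0 < (Matrix.gram ℝ fun i => intVec (b i)).det :=
    (Matrix.posDef_gram_of_linearIndependent hli).det_pos
  have hgram : (Matrix.gram ℝ fun i => intVec (b i)) =
      (Matrix.of fun i j => ∑ k, b i k * b j k : Matrix ι ι ℤ).map (Int.cast : ℤ → ℝ) := by
    ext i j
    simp [Matrix.gram_apply, intVec, PiLp.inner_apply, mul_comm]
  have hdet := Int.cast_det (R := ℝ) (Matrix.of fun i j => ∑ k, b i k * b j k : Matrix ι ι ℤ)
  rw [hgram] at hpos ⊢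
  rw [← hdet] at hpos ⊢
  have : 0 < (Matrix.of fun i j => ∑ k, b i k * b j k : Matrix ι ι ℤ).det := by
    exact_mod_cast hpos
  exact_mod_cast this

theorem one_mem_gramDetSet_bot :
    (1 : ℝ) ∈ gramDetSet (⊥ : Submodule ℝ (EuclideanSpace ℝ (Fin K))) :=
  ⟨Empty, inferInstance, inferInstance, Empty.elim, linearIndependent_empty_type, by simp,
    by simp⟩

theorem mul_mem_gramDetSet_sup {n : ℝ} (hn : n ∈ gramDetSet V) {a : Fin K → ℤ}
    (ha : intVec a ∉ V) :
    n * ‖Vᗮ.starProjection (intVec a)‖ ^ 2 ∈ gramDetSet (V ⊔ Submodule.span ℝ {intVec a}) := by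
  have hn1 := one_le_of_mem_gramDetSet hn
  obtain ⟨ι, _, _, b, hli, hspan, rfl⟩ := hn
  have helim : (fun i => intVec (Sum.elim b (fun _ : Unit => a) i)) =
      Sum.elim (fun i => intVec (b i)) fun _ : Unit => intVec a := by
    funext i; rcases i with i | i <;> rfl
  have hdet := det_gram_sumElim (fun i => intVec (b i)) (intVec a)
    (Vᗮ.starProjection (intVec a)) (by
      rw [hspan, Submodule.starProjection_orthogonal_val, sub_sub_cancel]
      exact Submodule.starProjection_apply_mem _ _)
    (by rw [hspan]; exact Submodule.starProjection_apply_mem _ _)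
  have hw0 : Vᗮ.starProjection (intVec a) ≠ 0 := by
    intro h0
    rw [Submodule.starProjection_apply_eq_zero_iff, Submodule.orthogonal_orthogonal] at h0
    exact ha h0
  refine ⟨ι ⊕ Unit, inferInstance, inferInstance, Sum.elim b fun _ => a, ?_, ?_, ?_⟩
  · rw [helim]
    apply Matrix.linearIndependent_of_det_gram_ne_zero (𝕜 := ℝ)
    rw [hdet]
    have : 0 < ‖Vᗮ.starProjection (intVec a)‖ := norm_pos_iff.2 hw0
    positivity
  · rw [helim, Set.Sum.elim_range, Submodule.span_union, hspan, Set.range_const]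
  · rw [helim, hdet]

theorem one_le_sqHeight (hV : (gramDetSet V).Nonempty) : 1 ≤ sqHeight V :=
  le_csInf hV fun _ => one_le_of_mem_gramDetSet

theorem sqHeight_bot_le : sqHeight (⊥ : Submodule ℝ (EuclideanSpace ℝ (Fin K))) ≤ 1 :=
  csInf_le ⟨1, fun _ => one_le_of_mem_gramDetSet⟩ one_mem_gramDetSet_bot

theorem sqHeight_sup_le (hV : (gramDetSet V).Nonempty) {a : Fin K → ℤ} (ha : intVec a ∉ V) :
    sqHeight (V ⊔ Submodule.span ℝ {intVec a}) ≤
      sqHeight V * ‖Vᗮ.starProjection (intVec a)‖ ^ 2 := by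
  have hw0 : Vᗮ.starProjection (intVec a) ≠ 0 := by
    intro h0
    rw [Submodule.starProjection_apply_eq_zero_iff, Submodule.orthogonal_orthogonal] at h0
    exact ha h0
  have : 0 < ‖Vᗮ.starProjection (intVec a)‖ := norm_pos_iff.2 hw0
  rw [← div_le_iff₀ (by positivity)]
  refine le_csInf hV fun n hn => ?_
  rw [div_le_iff₀ (by positivity)]
  exact csInf_le ⟨1, fun _ => one_le_of_mem_gramDetSet⟩ (mul_mem_gramDetSet_sup hn ha)

end height

/-- Squared covolume of the part over `V` of the lattice of norm
`(β, v) ↦ ‖β • h - v‖ ^ 2 + β ^ 2 / S`, rescaled to total covolume one. -/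
noncomputable def latticeCovol {K : ℕ} (S : ℝ) (V : Submodule ℝ (EuclideanSpace ℝ (Fin K)))
    (h : EuclideanSpace ℝ (Fin K)) : ℝ :=
  S ^ ((Module.finrank ℝ V : ℝ) / K - 1) *
    (sqHeight V * (1 + S * ‖Vᗮ.starProjection h‖ ^ 2))

open Classical in
/-- The subspaces spanned by subsets of a finite set of integer vectors. -/
noncomputable def spanFamily {K : ℕ} (W : Finset (Fin K → ℤ)) :
    Finset (Submodule ℝ (EuclideanSpace ℝ (Fin K))) :=
  W.powerset.image fun T : Finset (Fin K → ℤ) => Submodule.span ℝ (intVec '' (T : Set (Fin K → ℤ)))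

section
variable {K : ℕ}

theorem finrank_sup_span_singleton {E : Type*} [AddCommGroup E] [Module ℝ E]
    [FiniteDimensional ℝ E] (V : Submodule ℝ E) {v : E} (hv : v ∉ V) :
    Module.finrank ℝ (V ⊔ Submodule.span ℝ {v} : Submodule ℝ E) = Module.finrank ℝ V + 1 := by
  have hv0 : v ≠ 0 := fun h0 => hv (h0 ▸ V.zero_mem)
  have h1 := Submodule.finrank_sup_add_finrank_inf_eq V (Submodule.span ℝ {v})
  have h2 : V ⊓ Submodule.span ℝ {v} = ⊥ := by
    rw [Submodule.eq_bot_iff]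
    rintro x ⟨hx, hx'⟩
    obtain ⟨c, rfl⟩ := Submodule.mem_span_singleton.1 hx'
    by_contra hne
    have hc : c ≠ 0 := fun h0 => hne (by simp [h0])
    exact hv ((V.smul_mem_iff hc).1 hx)
  rw [h2, finrank_bot, finrank_span_singleton hv0] at h1
  omega

theorem latticeCovol_sup_le {S : ℝ} (hS : 0 < S)
    {V : Submodule ℝ (EuclideanSpace ℝ (Fin K))} (hV : (gramDetSet V).Nonempty)
    {a : Fin K → ℤ} (ha : intVec a ∉ V) (h : EuclideanSpace ℝ (Fin K)) (β : ℝ) :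
    latticeCovol S (V ⊔ Submodule.span ℝ {intVec a}) h ≤
      latticeCovol S V h *
        (S ^ (1 / K : ℝ) * (‖β • h - intVec a‖ ^ 2 + β ^ 2 / S)) := by
  unfold latticeCovol
  rw [finrank_sup_span_singleton V ha]
  have hpow : S ^ (((Module.finrank ℝ V + 1 : ℕ) : ℝ) / K - 1) =
      S ^ ((Module.finrank ℝ V : ℝ) / K - 1) * S ^ (1 / K : ℝ) := by
    rw [← Real.rpow_add hS]
    congr 1
    push_cast
    ring
  rw [hpow]
  have h1 := sqHeight_sup_le hV ha
  have h2 := norm_proj_sup_span_le V ha h β hS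
  have h3 := one_le_sqHeight hV
  set H' := sqHeight (V ⊔ Submodule.span ℝ {intVec a})
  set H := sqHeight V
  set q := ‖β • h - intVec a‖ ^ 2 + β ^ 2 / S
  set G' := 1 + S * ‖(V ⊔ Submodule.span ℝ {intVec a})ᗮ.starProjection h‖ ^ 2
  have hG' : 0 ≤ G' := by positivity
  have h4 : H' * G' ≤ H * (1 + S * ‖Vᗮ.starProjection h‖ ^ 2) * q :=
    calc H' * G' ≤ H * ‖Vᗮ.starProjection (intVec a)‖ ^ 2 * G' := by gcongr
      _ = H * (‖Vᗮ.starProjection (intVec a)‖ ^ 2 * G') := by ring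
      _ ≤ H * ((1 + S * ‖Vᗮ.starProjection h‖ ^ 2) * q) := by gcongr
      _ = _ := by ring
  calc _ = S ^ ((Module.finrank ℝ V : ℝ) / K - 1) * S ^ (1 / K : ℝ) * (H' * G') := by ring
    _ ≤ S ^ ((Module.finrank ℝ V : ℝ) / K - 1) * S ^ (1 / K : ℝ) *
        (H * (1 + S * ‖Vᗮ.starProjection h‖ ^ 2) * q) := by gcongr
    _ = _ := by ring

theorem bot_mem_spanFamily (W : Finset (Fin K → ℤ)) : ⊥ ∈ spanFamily W := by
  classical
  exact Finset.mem_image.2 ⟨∅, by simp, by simp⟩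

theorem sup_mem_spanFamily {W : Finset (Fin K → ℤ)}
    {V : Submodule ℝ (EuclideanSpace ℝ (Fin K))} (hV : V ∈ spanFamily W) {a : Fin K → ℤ}
    (ha : a ∈ W) : V ⊔ Submodule.span ℝ {intVec a} ∈ spanFamily W := by
  classical
  obtain ⟨T, hT, rfl⟩ := Finset.mem_image.1 hV
  rw [Finset.mem_powerset] at hT
  refine Finset.mem_image.2 ⟨insert a T, ?_, ?_⟩
  · rw [Finset.mem_powerset]
    exact Finset.insert_subset ha hT
  · rw [Finset.coe_insert, Set.image_insert_eq, Submodule.span_insert, sup_comm]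

theorem gramDetSet_nonempty_of_mem_spanFamily {W : Finset (Fin K → ℤ)}
    {V : Submodule ℝ (EuclideanSpace ℝ (Fin K))} (hV : V ∈ spanFamily W) :
    (gramDetSet V).Nonempty := by
  classical
  obtain ⟨T, -, rfl⟩ := Finset.mem_image.1 hV
  clear hV
  induction T using Finset.induction_on with
  | empty => exact ⟨1, by simpa using one_mem_gramDetSet_bot⟩
  | insert a T _ ih =>
    rw [Finset.coe_insert, Set.image_insert_eq, Submodule.span_insert, sup_comm]
    by_cases ha : intVec a ∈ Submodule.span ℝ (intVec '' (T : Set (Fin K → ℤ)))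
    · rwa [sup_eq_left.2 (by simpa using ha)]
    · obtain ⟨n, hn⟩ := ih
      exact ⟨_, mul_mem_gramDetSet_sup hn ha⟩

theorem card_chain_le (F : Finset (Submodule ℝ (EuclideanSpace ℝ (Fin K))))
    (hF : ∀ V ∈ F, ∀ V' ∈ F, V ≤ V' ∨ V' ≤ V) : F.card ≤ K + 1 := by
  rw [← Finset.card_range (K + 1)]
  refine Finset.card_le_card_of_injOn (fun V => Module.finrank ℝ V) ?_ ?_
  · intro V _
    have := Submodule.finrank_le V
    rw [finrank_euclideanSpace_fin] at this
    simpa using Nat.lt_succ_of_le this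
  · intro V hV V' hV' hVV'
    rcases hF V hV V' hV' with h | h
    · exact Submodule.eq_of_le_of_finrank_eq h hVV'
    · exact (Submodule.eq_of_le_of_finrank_eq h hVV'.symm).symm

theorem latticeCovol_bot_le {S : ℝ} (hS : 0 < S) (h : EuclideanSpace ℝ (Fin K)) :
    latticeCovol S ⊥ h ≤ S⁻¹ + ‖h‖ ^ 2 := by
  unfold latticeCovol
  have h1 := Submodule.norm_starProjection_apply_le
    (⊥ : Submodule ℝ (EuclideanSpace ℝ (Fin K)))ᗮ h
  rw [finrank_bot]
  have e : S ^ (((0 : ℕ) : ℝ) / K - 1) = S⁻¹ := by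
    rw [Nat.cast_zero, zero_div, zero_sub, Real.rpow_neg_one]
  rw [e]
  calc S⁻¹ * (sqHeight (⊥ : Submodule ℝ (EuclideanSpace ℝ (Fin K))) *
        (1 + S * ‖(⊥ : Submodule ℝ (EuclideanSpace ℝ (Fin K)))ᗮ.starProjection h‖ ^ 2))
      ≤ S⁻¹ * (1 * (1 + S * ‖h‖ ^ 2)) := by gcongr; exact sqHeight_bot_le
    _ = _ := by field_simp

theorem lt_of_isMarked {S : ℝ} (hS : 0 < S)
    {g : ℝ → EuclideanSpace ℝ (Fin K)} {W : Finset (Fin K → ℤ)} {ε ρ θ M x : ℝ}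
    (hmark : IsMarked (fun V V' => V ≤ V' ∨ V' ≤ V) (fun V y => latticeCovol S V (g y)) ε ρ
      (spanFamily W) x)
    (hερ : ε ≤ ρ) (hρM : ρ ≤ M) (hM : S⁻¹ + ‖g x‖ ^ 2 ≤ M) (hθε : M * θ < ε)
    {a : Fin K → ℤ} (haW : a ∈ W) (ha : intVec a ≠ 0) (β : ℝ) :
    θ < S ^ (1 / K : ℝ) * (‖β • g x - intVec a‖ ^ 2 + β ^ 2 / S) := by
  classical
  obtain ⟨F, hFW, hchain, hF, hnF⟩ := hmark
  by_contra! hcon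
  -- the largest member of the flag missing `a`
  obtain ⟨V, hVW, haV, hVM, hcomp⟩ : ∃ V ∈ spanFamily W, intVec a ∉ V ∧
      latticeCovol S V (g x) ≤ M ∧ ∀ V' ∈ F, V' ≤ V ∨ (V ≤ V' ∧ intVec a ∈ V') := by
    by_cases hne : (F.filter fun V => intVec a ∉ V).Nonempty
    · obtain ⟨V, hV⟩ := (F.filter fun V => intVec a ∉ V).exists_maximal hne
      have hVF := Finset.mem_filter.1 hV.1
      refine ⟨V, hFW hVF.1, hVF.2, (hF V hVF.1).2.trans hρM, fun V' hV' => ?_⟩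
      by_cases haV' : intVec a ∈ V'
      · rcases hchain V hVF.1 V' hV' with h | h
        · exact Or.inr ⟨h, haV'⟩
        · exact Or.inl h
      · rcases hchain V hVF.1 V' hV' with h | h
        · exact Or.inl (hV.2 (Finset.mem_filter.2 ⟨hV', haV'⟩) h)
        · exact Or.inl h
    · refine ⟨⊥, bot_mem_spanFamily W, by simpa using ha,
        (latticeCovol_bot_le hS _).trans hM, fun V' hV' => Or.inr ⟨bot_le, ?_⟩⟩
      by_contra haV'
      exact hne ⟨V', Finset.mem_filter.2 ⟨hV', haV'⟩⟩
  have hsup := latticeCovol_sup_le hS (gramDetSet_nonempty_of_mem_spanFamily hVW) haV (g x) β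
  have hlow : ε ≤ latticeCovol S (V ⊔ Submodule.span ℝ {intVec a}) (g x) := by
    by_cases hmem : V ⊔ Submodule.span ℝ {intVec a} ∈ F
    · exact (hF _ hmem).1
    · refine hερ.trans (hnF _ (sup_mem_spanFamily hVW haW) hmem fun V' hV' => ?_)
      rcases hcomp V' hV' with h | ⟨h, haV'⟩
      · exact Or.inr (h.trans le_sup_left)
      · exact Or.inl (sup_le h (by simpa using haV'))
  have hq : 0 ≤ S ^ (1 / K : ℝ) * (‖β • g x - intVec a‖ ^ 2 + β ^ 2 / S) := by positivity
  have hM0 : 0 ≤ M := le_trans (by positivity) hM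
  have : latticeCovol S V (g x) * (S ^ (1 / K : ℝ) * (‖β • g x - intVec a‖ ^ 2 + β ^ 2 / S)) ≤
      M * θ := mul_le_mul hVM hcon hq hM0
  linarith

end

section
variable {K : ℕ}

theorem exists_inner_lower_bound {E : Type*} [NormedAddCommGroup E] [InnerProductSpace ℝ E]
    [FiniteDimensional ℝ E] {g : ℝ → E} (hg : Continuous g) {A B : ℝ} (hAB : A ≤ B)
    (h : ∀ u : E, u ≠ 0 → ∃ x ∈ Set.Icc A B, ⟪u, g x⟫ ≠ 0) :
    ∃ c > 0, ∀ u : E, ∃ x ∈ Set.Icc A B, c * ‖u‖ ≤ |⟪u, g x⟫| := by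
  let L : E →ₗ[ℝ] C(Set.Icc A B, ℝ) :=
    { toFun := fun u => ⟨fun x => ⟪u, g x⟫, by fun_prop⟩
      map_add' := fun u v => by ext x; simp [inner_add_left]
      map_smul' := fun c u => by ext x; simp [inner_smul_left] }
  have hL : LinearMap.ker L = ⊥ := by
    rw [LinearMap.ker_eq_bot']
    intro u hu
    by_contra hne
    obtain ⟨x, hx, hux⟩ := h u hne
    exact hux (congrArg (fun F : C(Set.Icc A B, ℝ) => F ⟨x, hx⟩) hu)
  obtain ⟨k, hk, hanti⟩ := L.exists_antilipschitzWith hL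
  have hk' : (0 : ℝ) < k := hk
  refine ⟨1 / (2 * k), by positivity, fun u => ?_⟩
  rcases eq_or_ne u 0 with rfl | hu
  · exact ⟨A, Set.left_mem_Icc.2 hAB, by simp⟩
  by_contra! hcon
  have h1 : ‖L u‖ ≤ 1 / (2 * k) * ‖u‖ := by
    rw [ContinuousMap.norm_le _ (by positivity)]
    exact fun x => (hcon x x.2).le
  have h2 : ‖u‖ ≤ k * ‖L u‖ := by
    simpa using hanti.le_mul_dist u 0
  have h3 : 0 < ‖u‖ := norm_pos_iff.2 hu
  have h4 : (k : ℝ) * ‖L u‖ ≤ k * (1 / (2 * k) * ‖u‖) := by gcongr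
  have h5 : (k : ℝ) * (1 / (2 * k) * ‖u‖) = ‖u‖ / 2 := by field_simp
  linarith

theorem latticeCovol_nonneg {S : ℝ} (hS : 0 < S)
    {V : Submodule ℝ (EuclideanSpace ℝ (Fin K))} (hV : (gramDetSet V).Nonempty)
    (h : EuclideanSpace ℝ (Fin K)) : 0 ≤ latticeCovol S V h := by
  have := one_le_sqHeight hV
  unfold latticeCovol
  positivity

theorem le_latticeCovol_of_inner {S : ℝ} (hS : 1 ≤ S)
    {V : Submodule ℝ (EuclideanSpace ℝ (Fin K))} (hV : (gramDetSet V).Nonempty)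
    {u h : EuclideanSpace ℝ (Fin K)} (hu : u ∈ Vᗮ) (hu1 : ‖u‖ = 1) {c : ℝ} (hc : 0 ≤ c)
    (hcu : c ≤ |⟪u, h⟫|) : c ^ 2 ≤ latticeCovol S V h := by
  have hS0 : 0 < S := by linarith
  have h1 : c ≤ ‖Vᗮ.starProjection h‖ := by
    have e : ⟪u, h⟫ = ⟪u, Vᗮ.starProjection h⟫ := by
      rw [← Submodule.inner_starProjection_left_eq_right,
        Submodule.starProjection_eq_self_iff.2 hu]
    rw [e] at hcu
    simpa [hu1] using hcu.trans (abs_real_inner_le_norm _ _)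
  have h2 : S⁻¹ ≤ S ^ ((Module.finrank ℝ V : ℝ) / K - 1) := by
    rw [← Real.rpow_neg_one]
    have : 0 ≤ (Module.finrank ℝ V : ℝ) / K := by positivity
    exact Real.rpow_le_rpow_of_exponent_le hS (by linarith)
  have h3 := one_le_sqHeight hV
  have h4 : c ^ 2 ≤ ‖Vᗮ.starProjection h‖ ^ 2 := by gcongr
  unfold latticeCovol
  calc c ^ 2 = S⁻¹ * (1 * (S * c ^ 2)) := by field_simp
    _ ≤ S ^ ((Module.finrank ℝ V : ℝ) / K - 1) *
        (sqHeight V * (1 + S * ‖Vᗮ.starProjection h‖ ^ 2)) := by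
      gcongr
      nlinarith

theorem one_le_latticeCovol_top (hK : 1 ≤ K) {S : ℝ} (hS : 0 < S)
    (hV : (gramDetSet (⊤ : Submodule ℝ (EuclideanSpace ℝ (Fin K)))).Nonempty)
    (h : EuclideanSpace ℝ (Fin K)) : 1 ≤ latticeCovol S ⊤ h := by
  have h3 := one_le_sqHeight hV
  have hK' : (K : ℝ) ≠ 0 := by positivity
  unfold latticeCovol
  rw [finrank_top, finrank_euclideanSpace_fin, div_self hK', sub_self, Real.rpow_zero, one_mul]
  have : 0 ≤ S * ‖(⊤ : Submodule ℝ (EuclideanSpace ℝ (Fin K)))ᗮ.starProjection h‖ ^ 2 := by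
    positivity
  nlinarith

theorem exists_le_latticeCovol (hK : 1 ≤ K) {g : ℝ → EuclideanSpace ℝ (Fin K)} {A B c : ℝ}
    (hAB : A ≤ B) (hc : 0 < c)
    (hcg : ∀ u : EuclideanSpace ℝ (Fin K), ∃ x ∈ Set.Icc A B, c * ‖u‖ ≤ |⟪u, g x⟫|)
    {S : ℝ} (hS : 1 ≤ S) {V : Submodule ℝ (EuclideanSpace ℝ (Fin K))}
    (hV : (gramDetSet V).Nonempty) :
    ∃ x ∈ Set.Icc A B, min 1 (c ^ 2) ≤ latticeCovol S V (g x) := by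
  by_cases htop : V = ⊤
  · subst htop
    exact ⟨A, Set.left_mem_Icc.2 hAB, (min_le_left _ _).trans
      (one_le_latticeCovol_top hK (by linarith) hV _)⟩
  · have hne : Vᗮ ≠ ⊥ := by rwa [ne_eq, Submodule.orthogonal_eq_bot_iff]
    obtain ⟨u, hu, hu0⟩ := Submodule.exists_mem_ne_zero_of_ne_bot hne
    have hu1 : 0 < ‖u‖ := norm_pos_iff.2 hu0
    obtain ⟨x, hx, hxc⟩ := hcg (‖u‖⁻¹ • u)
    have hn : ‖‖u‖⁻¹ • u‖ = 1 := by rw [norm_smul, norm_inv, norm_norm]; field_simp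
    rw [hn, mul_one] at hxc
    exact ⟨x, hx, (min_le_right _ _).trans
      (le_latticeCovol_of_inner hS hV (Vᗮ.smul_mem _ hu) hn hc.le hxc)⟩

/-- The constant function and the pairwise products of the coordinates of a curve. -/
def quadraticFamily (g : ℝ → EuclideanSpace ℝ (Fin K)) : Option (Fin K × Fin K) → ℝ → ℝ
  | none => fun _ => 1
  | some (i, j) => fun x => g x i * g x j

theorem norm_starProjection_sq_eq (V : Submodule ℝ (EuclideanSpace ℝ (Fin K)))
    (h : EuclideanSpace ℝ (Fin K)) :
    ‖V.starProjection h‖ ^ 2 = ∑ i, ∑ j,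
      (V.starProjection (EuclideanSpace.basisFun (Fin K) ℝ j)) i * (h i * h j) := by
  have h1 : ‖V.starProjection h‖ ^ 2 = ⟪h, V.starProjection h⟫ := by
    rw [← real_inner_self_eq_norm_sq, Submodule.inner_starProjection_left_eq_right,
      Submodule.starProjection_eq_self_iff.2 (Submodule.starProjection_apply_mem _ _)]
  have h2 : V.starProjection h =
      ∑ j, h j • V.starProjection (EuclideanSpace.basisFun (Fin K) ℝ j) := by
    conv_lhs => rw [← (EuclideanSpace.basisFun (Fin K) ℝ).sum_repr h]
    rw [map_sum]
    exact Finset.sum_congr rfl fun j _ => by rw [map_smul, EuclideanSpace.basisFun_repr]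
  rw [h1, PiLp.inner_apply]
  refine Finset.sum_congr rfl fun i _ => ?_
  rw [h2]
  simp only [WithLp.ofLp_sum, WithLp.ofLp_smul, Finset.sum_apply, Pi.smul_apply, smul_eq_mul,
    RCLike.inner_apply, conj_trivial, Finset.sum_mul]
  exact Finset.sum_congr rfl fun j _ => by ring

theorem latticeCovol_mem_span (S : ℝ) (V : Submodule ℝ (EuclideanSpace ℝ (Fin K)))
    (g : ℝ → EuclideanSpace ℝ (Fin K)) :
    (fun x => latticeCovol S V (g x)) ∈ Submodule.span ℝ (Set.range (quadraticFamily g)) := by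
  have e : (fun x => latticeCovol S V (g x)) =
      (S ^ ((Module.finrank ℝ V : ℝ) / K - 1) * sqHeight V) •
        (quadraticFamily g none + S • ∑ i, ∑ j,
          (Vᗮ.starProjection (EuclideanSpace.basisFun (Fin K) ℝ j)) i •
            quadraticFamily g (some (i, j))) := by
    funext x
    rw [latticeCovol, norm_starProjection_sq_eq]
    simp [quadraticFamily, mul_assoc]
  have hm : ∀ o, quadraticFamily g o ∈ Submodule.span ℝ (Set.range (quadraticFamily g)) :=
    fun o => Submodule.subset_span ⟨o, rfl⟩
  rw [e]
  exact Submodule.smul_mem _ _ (add_mem (hm _) (Submodule.smul_mem _ _ (sum_mem fun i _ =>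
    sum_mem fun j _ => Submodule.smul_mem _ _ (hm _))))

theorem continuous_latticeCovol (S : ℝ) (V : Submodule ℝ (EuclideanSpace ℝ (Fin K))) :
    Continuous (latticeCovol S V) := by
  unfold latticeCovol
  fun_prop

end

/-- Along powers of two, the lattice attached to `h` has no vectors that are too short. -/
def IsExtremal {K : ℕ} (h : EuclideanSpace ℝ (Fin K)) : Prop :=
  ∀ p : ℕ, ∀ᶠ n : ℕ in Filter.atTop, ∀ a : Fin K → ℤ, a ≠ 0 → ∀ β : ℝ,
    ((2 : ℝ) ^ n) ^ (-(1 / (K : ℝ) + 1 / (p + 1))) ≤ ‖β • h - intVec a‖ ^ 2 + β ^ 2 / 2 ^ n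

section
variable {K : ℕ}

theorem intVec_ne_zero {a : Fin K → ℤ} (ha : a ≠ 0) : intVec a ≠ 0 := by
  intro h0
  apply ha
  funext i
  have := congrArg (fun v : EuclideanSpace ℝ (Fin K) => v i) h0
  simpa [intVec] using this

theorem abs_le_of_short {S M : ℝ} (hS : 1 ≤ S) {h : EuclideanSpace ℝ (Fin K)}
    (hM : 1 + ‖h‖ ^ 2 ≤ M) {a : Fin K → ℤ} {β : ℝ}
    (hq : ‖β • h - intVec a‖ ^ 2 + β ^ 2 / S ≤ 1) (i : Fin K) : |(a i : ℝ)| ≤ 1 + S * M := by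
  have hS0 : 0 < S := by linarith
  have h1 : ‖β • h - intVec a‖ ≤ 1 := by
    have : 0 ≤ β ^ 2 / S := by positivity
    nlinarith [norm_nonneg (β • h - intVec a)]
  have h2 : |β| ≤ S := by
    have h3 : β ^ 2 / S ≤ 1 := by nlinarith [sq_nonneg ‖β • h - intVec a‖]
    rw [div_le_one hS0] at h3
    exact abs_le_of_sq_le_sq (by nlinarith) hS0.le
  have h4 : ‖h‖ ≤ M := by nlinarith [sq_nonneg (‖h‖ - 1), norm_nonneg h]
  have h5 : |(a i : ℝ)| ≤ ‖intVec a‖ := PiLp.norm_apply_le (intVec a) i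
  have h6 : ‖intVec a‖ ≤ ‖β • h - intVec a‖ + ‖β • h‖ := by
    have := norm_sub_le (β • h) (β • h - intVec a)
    rw [sub_sub_cancel] at this
    linarith
  rw [norm_smul, Real.norm_eq_abs] at h6
  have h7 : |β| * ‖h‖ ≤ S * M := by gcongr
  linarith

/-- The integer vectors with coordinates at most `R` in absolute value. -/
noncomputable def intBox (K : ℕ) (R : ℤ) : Finset (Fin K → ℤ) :=
  Fintype.piFinset fun _ => Finset.Icc (-R) R

theorem volume_not_isMarked_latticeCovol_le (hK : 1 ≤ K) {g : ℝ → EuclideanSpace ℝ (Fin K)}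
    (hg : Continuous g) {A B c C : ℝ} {D : ℕ} (hAB : A < B) (hc : 0 < c)
    (hcg : ∀ u : EuclideanSpace ℝ (Fin K), ∃ x ∈ Set.Icc A B, c * ‖u‖ ≤ |⟪u, g x⟫|)
    (hC : ∀ F ∈ Submodule.span ℝ (Set.range (quadraticFamily g)), ∀ a b : ℝ, A ≤ a → a < b →
      b ≤ B → ∀ ε ρ τ : ℝ, 0 < τ → τ ≤ 1 → C * ε < ρ * τ ^ D →
      (∃ y ∈ Set.Icc a b, ρ ≤ |F y|) →
      volume {x | x ∈ Set.Ioo a b ∧ |F x| < ε} ≤ ENNReal.ofReal (τ * (b - a)))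
    {S : ℝ} (hS : 1 ≤ S) {ε τ : ℝ} (hτ : 0 < τ) (hτ1 : τ ≤ 1)
    (hε : C * ε < min 1 (c ^ 2) * τ ^ D) (W : Finset (Fin K → ℤ)) :
    volume {x | x ∈ Set.Ioo A B ∧ ¬ IsMarked (fun V V' => V ≤ V' ∨ V' ≤ V)
      (fun V y => latticeCovol S V (g y)) ε (min 1 (c ^ 2)) (spanFamily W) x} ≤
      ENNReal.ofReal ((4 ^ (K + 1) - 1) * τ * (B - A)) := by
  have hS0 : 0 < S := by linarith
  have hgood : ∀ V ∈ spanFamily W, ∀ a b, A ≤ a → a < b → b ≤ B →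
      (∃ z ∈ Set.Icc a b, min 1 (c ^ 2) ≤ latticeCovol S V (g z)) →
      volume {x | x ∈ Set.Ioo a b ∧ latticeCovol S V (g x) < ε} ≤
        ENNReal.ofReal (τ * (b - a)) := by
    intro V hV a b ha hab hb hz
    have habs : ∀ x, |latticeCovol S V (g x)| = latticeCovol S V (g x) := fun x =>
      abs_of_nonneg (latticeCovol_nonneg hS0 (gramDetSet_nonempty_of_mem_spanFamily hV) _)
    have := hC _ (latticeCovol_mem_span S V g) a b ha hab hb ε _ τ hτ hτ1 hε
    simp only [habs] at this
    exact this hz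
  have hlarge : ∀ V ∈ spanFamily W, ∃ z ∈ Set.Icc A B, min 1 (c ^ 2) ≤ latticeCovol S V (g z) :=
    fun V hV => exists_le_latticeCovol hK hAB.le hc hcg hS
      (gramDetSet_nonempty_of_mem_spanFamily hV)
  have hcont : ∀ V, Continuous fun y => latticeCovol S V (g y) := fun V =>
    (continuous_latticeCovol S V).comp hg
  exact volume_not_isMarked_le
    (R := fun V V' : Submodule ℝ (EuclideanSpace ℝ (Fin K)) => V ≤ V' ∨ V' ≤ V)
    (ψ := fun V y => latticeCovol S V (g y)) (fun V => Or.inl le_rfl) (fun V V' h => h.symm)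
    hcont hτ.le (spanFamily W) hgood (K + 1) (spanFamily W) (Finset.Subset.refl _)
    (fun F _ hF => card_chain_le F hF) A B le_rfl hAB le_rfl hlarge

open Filter Topology in
theorem ae_isExtremal_of_local (hK : 1 ≤ K) {g : ℝ → EuclideanSpace ℝ (Fin K)}
    (hg : Continuous g) {A B c C : ℝ} {D : ℕ} (hAB : A < B) (hc : 0 < c)
    (hcg : ∀ u : EuclideanSpace ℝ (Fin K), ∃ x ∈ Set.Icc A B, c * ‖u‖ ≤ |⟪u, g x⟫|)
    (hC : ∀ F ∈ Submodule.span ℝ (Set.range (quadraticFamily g)), ∀ a b : ℝ, A ≤ a → a < b →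
      b ≤ B → ∀ ε ρ τ : ℝ, 0 < τ → τ ≤ 1 → C * ε < ρ * τ ^ D →
      (∃ y ∈ Set.Icc a b, ρ ≤ |F y|) →
      volume {x | x ∈ Set.Ioo a b ∧ |F x| < ε} ≤ ENNReal.ofReal (τ * (b - a))) :
    ∀ᵐ x, x ∈ Set.Ioo A B → IsExtremal (g x) := by
  have hρ : 0 < min 1 (c ^ 2) := lt_min one_pos (by positivity)
  obtain ⟨M, hM⟩ : ∃ M : ℝ, ∀ x ∈ Set.Icc A B, 1 + ‖g x‖ ^ 2 ≤ M := by
    have hb := (isCompact_Icc (a := A) (b := B)).bddAbove_image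
      (f := fun x => 1 + ‖g x‖ ^ 2) (by fun_prop)
    obtain ⟨M, hM⟩ := hb
    exact ⟨M, fun x hx => hM ⟨x, hx, rfl⟩⟩
  have hM1 : 1 ≤ M := by
    have := hM A (Set.left_mem_Icc.2 hAB.le)
    nlinarith [sq_nonneg ‖g A‖]
  suffices hp : ∀ p : ℕ, ∀ᵐ x, x ∈ Set.Ioo A B → ∀ᶠ n : ℕ in atTop, ∀ a : Fin K → ℤ, a ≠ 0 →
      ∀ β : ℝ, ((2 : ℝ) ^ n) ^ (-(1 / (K : ℝ) + 1 / (p + 1))) ≤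
        ‖β • g x - intVec a‖ ^ 2 + β ^ 2 / 2 ^ n by
    filter_upwards [ae_all_iff.2 hp] with x hx hxAB p using hx p hxAB
  intro p
  set s : ℝ := 2 ^ (-(1 / (((p : ℝ) + 1) * (D + 1)))) with hs
  have hs0 : 0 < s := by positivity
  have hs1 : s < 1 := Real.rpow_lt_one_of_one_lt_of_neg one_lt_two (by
    rw [neg_lt_zero]; positivity)
  have hsn : ∀ n : ℕ, (s ^ (D + 1)) ^ n = ((2 : ℝ) ^ n) ^ (-(1 / ((p : ℝ) + 1))) := by
    intro n
    rw [hs, ← pow_mul, ← Real.rpow_natCast, ← Real.rpow_mul (by norm_num), ← Real.rpow_natCast 2,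
      ← Real.rpow_mul (by norm_num)]
    congr 1
    push_cast
    field_simp
  -- eventually the parameters are admissible
  have hev : ∀ᶠ n : ℕ in atTop, C * (2 * M * (s ^ (D + 1)) ^ n) < min 1 (c ^ 2) * (s ^ n) ^ D ∧
      2 * M * (s ^ (D + 1)) ^ n ≤ min 1 (c ^ 2) := by
    have ht := tendsto_pow_atTop_nhds_zero_of_lt_one hs0.le hs1
    have h1 : ∀ᶠ n : ℕ in atTop, C * (2 * M) * s ^ n < min 1 (c ^ 2) := by
      have := ht.const_mul (C * (2 * M))
      rw [mul_zero] at this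
      exact this.eventually_lt_const hρ
    have h2 : ∀ᶠ n : ℕ in atTop, 2 * M * s ^ n < min 1 (c ^ 2) := by
      have := ht.const_mul (2 * M)
      rw [mul_zero] at this
      exact this.eventually_lt_const hρ
    filter_upwards [h1, h2] with n h1 h2
    have e : (s ^ (D + 1)) ^ n = s ^ n * (s ^ n) ^ D := by ring
    have h3 : (s ^ n) ^ D ≤ 1 := pow_le_one₀ (by positivity) (pow_le_one₀ hs0.le hs1.le)
    rw [e]
    constructor
    · calc _ = C * (2 * M) * s ^ n * (s ^ n) ^ D := by ring
        _ < _ := by gcongr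
    · calc _ = 2 * M * s ^ n * (s ^ n) ^ D := by ring
        _ ≤ 2 * M * s ^ n * 1 := by gcongr
        _ ≤ _ := by linarith
  obtain ⟨N, hN⟩ := eventually_atTop.1 hev
  let R : ℕ → ℤ := fun n => ⌈1 + (2 : ℝ) ^ n * M⌉
  let bad : ℕ → Set ℝ := fun n => {x | x ∈ Set.Ioo A B ∧ ¬ IsMarked (fun V V' => V ≤ V' ∨ V' ≤ V)
      (fun V y => latticeCovol ((2 : ℝ) ^ n) V (g y)) (2 * M * (s ^ (D + 1)) ^ n) (min 1 (c ^ 2))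
      (spanFamily (intBox K (R n))) x}
  have hbad : ∑' n, volume (bad (n + N)) ≠ ⊤ := by
    have h1 : ∀ n, volume (bad (n + N)) ≤
        ENNReal.ofReal ((4 ^ (K + 1) - 1) * s ^ (n + N) * (B - A)) := fun n =>
      volume_not_isMarked_latticeCovol_le hK hg hAB hc hcg hC (one_le_pow₀ one_le_two)
        (by positivity) (pow_le_one₀ hs0.le hs1.le) (hN _ (Nat.le_add_left _ _)).1 _
    refine ne_top_of_le_ne_top ?_ (ENNReal.tsum_le_tsum h1)
    have hsum : Summable fun n : ℕ => (4 ^ (K + 1) - 1) * s ^ (n + N) * (B - A) := by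
      refine Summable.mul_right _ (Summable.mul_left _ ?_)
      exact (summable_nat_add_iff N).2 (summable_geometric_of_lt_one hs0.le hs1)
    rw [← ENNReal.ofReal_tsum_of_nonneg _ hsum]
    · exact ENNReal.ofReal_ne_top
    · intro n
      have : (1 : ℝ) ≤ 4 ^ (K + 1) := one_le_pow₀ (by norm_num)
      have h2 : 0 < s ^ (n + N) := by positivity
      exact mul_nonneg (mul_nonneg (by linarith) h2.le) (by linarith)
  filter_upwards [ae_eventually_notMem hbad] with x hx hxAB
  have hx' : ∀ᶠ n : ℕ in atTop, x ∉ bad n := by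
    obtain ⟨N', hN'⟩ := eventually_atTop.1 hx
    refine eventually_atTop.2 ⟨N' + N, fun n hn => ?_⟩
    have := hN' (n - N) (by omega)
    rwa [Nat.sub_add_cancel (by omega)] at this
  filter_upwards [hx', hev] with n hn hpar a ha β
  have hmark := not_and_not_right.1 hn hxAB
  have hS1 : (1 : ℝ) ≤ 2 ^ n := one_le_pow₀ one_le_two
  have hS0 : (0 : ℝ) < 2 ^ n := by positivity
  have hMx := hM x (Set.Ioo_subset_Icc_self hxAB)
  by_contra! hlt
  have hle1 : ((2 : ℝ) ^ n) ^ (-(1 / (K : ℝ) + 1 / (p + 1))) ≤ 1 :=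
    Real.rpow_le_one_of_one_le_of_nonpos hS1 (by rw [neg_nonpos]; positivity)
  have hbox : a ∈ intBox K (R n) := by
    refine Fintype.mem_piFinset.2 fun i => Finset.mem_Icc.2 (abs_le.1 ?_)
    have h1 := abs_le_of_short hS1 hMx (hlt.le.trans hle1) i
    have h2 : (|a i| : ℝ) ≤ (R n : ℝ) := h1.trans (Int.le_ceil _)
    exact_mod_cast h2
  have hθ : 0 < (s ^ (D + 1)) ^ n := by positivity
  have := lt_of_isMarked hS0 hmark hpar.2 ((min_le_left _ _).trans hM1)
    (le_trans (by gcongr; exact inv_le_one_of_one_le₀ hS1) hMx)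
    (θ := (s ^ (D + 1)) ^ n) (by nlinarith) hbox (intVec_ne_zero ha) β
  rw [hsn] at this
  have h3 : ((2 : ℝ) ^ n) ^ (1 / K : ℝ) * ((2 : ℝ) ^ n) ^ (-(1 / (K : ℝ) + 1 / (p + 1))) =
      ((2 : ℝ) ^ n) ^ (-(1 / ((p : ℝ) + 1))) := by
    rw [← Real.rpow_add hS0]
    congr 1
    ring
  rw [← h3] at this
  exact absurd (lt_of_mul_lt_mul_left this (by positivity)) (not_lt.2 hlt.le)

end

section
variable {K : ℕ}

open Filter Topology in
/-- Almost every point of a nondegenerate analytic curve is extremal. -/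
theorem ae_isExtremal_curve (hK : 1 ≤ K) {g : ℝ → EuclideanSpace ℝ (Fin K)}
    (hg : ∀ i, AnalyticOnNhd ℝ (fun x => g x i) Set.univ)
    (hli : ∀ u : EuclideanSpace ℝ (Fin K), u ≠ 0 → ∃ x, ⟪u, g x⟫ ≠ 0) :
    ∀ᵐ x, IsExtremal (g x) := by
  have hcont : Continuous g := by
    have : Continuous fun x i => g x i := continuous_pi fun i =>
      continuousOn_univ.1 (hg i).continuousOn
    exact (PiLp.continuous_toLp 2 _).comp this
  have hinner : ∀ u : EuclideanSpace ℝ (Fin K), AnalyticOnNhd ℝ (fun x => ⟪u, g x⟫) Set.univ := by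
    intro u x _
    simp only [PiLp.inner_apply, RCLike.inner_apply, conj_trivial]
    exact Finset.analyticAt_fun_sum _ fun i _ => (hg i x trivial).mul analyticAt_const
  have hquad : ∀ o, AnalyticOnNhd ℝ (quadraticFamily g o) Set.univ := by
    rintro (_ | ⟨i, j⟩)
    · exact fun x _ => analyticAt_const
    · exact fun x _ => (hg i x trivial).mul (hg j x trivial)
  refine measure_null_of_locally_null _ fun x₀ _ => ?_
  obtain ⟨δ, hδ, D, C, -, hC⟩ := exists_uniform_sublevel (quadraticFamily g) hquad x₀
  have hAB : x₀ - δ < x₀ + δ := by linarith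
  have hloc : ∀ u : EuclideanSpace ℝ (Fin K), u ≠ 0 →
      ∃ x ∈ Set.Icc (x₀ - δ) (x₀ + δ), ⟪u, g x⟫ ≠ 0 := by
    intro u hu
    by_contra! hcon
    obtain ⟨x, hx⟩ := hli u hu
    apply hx
    have hev : (fun x => ⟪u, g x⟫) =ᶠ[𝓝 x₀] fun _ => (0 : ℝ) := by
      filter_upwards [Icc_mem_nhds (show x₀ - δ < x₀ by linarith)
        (show x₀ < x₀ + δ by linarith)] with y hy using hcon y hy
    exact congrFun ((hinner u).eq_of_eventuallyEq (fun _ _ => analyticAt_const) hev) x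
  obtain ⟨c, hc, hcg⟩ := exists_inner_lower_bound hcont hAB.le hloc
  have hae := ae_isExtremal_of_local hK hcont hAB hc hcg hC
  refine ⟨{x | ¬ IsExtremal (g x)} ∩ Set.Ioo (x₀ - δ) (x₀ + δ), inter_mem_nhdsWithin _
    (Ioo_mem_nhds (by linarith) (by linarith)), ?_⟩
  rw [ae_iff] at hae
  refine measure_mono_null (fun x hx => ?_) hae
  exact fun h => hx.1 (h hx.2)

open Filter in
theorem measurableSet_isExtremal :
    MeasurableSet {h : EuclideanSpace ℝ (Fin K) | IsExtremal h} := by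
  have hclosed : ∀ p n : ℕ, IsClosed {h : EuclideanSpace ℝ (Fin K) | ∀ a : Fin K → ℤ, a ≠ 0 →
      ∀ β : ℝ, ((2 : ℝ) ^ n) ^ (-(1 / (K : ℝ) + 1 / (p + 1))) ≤
        ‖β • h - intVec a‖ ^ 2 + β ^ 2 / 2 ^ n} := by
    intro p n
    simp only [Set.ofPred_forall]
    exact isClosed_iInter fun a => isClosed_iInter fun _ => isClosed_iInter fun β =>
      isClosed_le (by fun_prop) (by fun_prop)
  have e : {h : EuclideanSpace ℝ (Fin K) | IsExtremal h} = ⋂ p : ℕ, ⋃ N : ℕ, ⋂ n : ℕ, ⋂ _ : N ≤ n,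
      {h : EuclideanSpace ℝ (Fin K) | ∀ a : Fin K → ℤ, a ≠ 0 →
      ∀ β : ℝ, ((2 : ℝ) ^ n) ^ (-(1 / (K : ℝ) + 1 / (p + 1))) ≤
        ‖β • h - intVec a‖ ^ 2 + β ^ 2 / 2 ^ n} := by
    ext h
    simp [IsExtremal, eventually_atTop]
  rw [e]
  exact MeasurableSet.iInter fun p => MeasurableSet.iUnion fun N => MeasurableSet.iInter fun n =>
    MeasurableSet.iInter fun _ => (hclosed p n).measurableSet

end

/-- Every target in the cube is approximated by `t ↦ (sin t, sin (exp t), …)` on every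
sufficiently remote interval of length seven. -/
theorem exists_sin_iterate_exp_near (m : ℕ) {ε : ℝ} (hε : 0 < ε) :
    ∀ u : ℕ → ℝ, (∀ j, u j ∈ Set.Icc (-1 : ℝ) 1) → ∃ T : ℝ, ∀ A ≥ T, ∃ z ∈ Set.Icc A (A + 7),
      ∀ j < m, |Real.sin (Real.exp^[j] z) - u j| < ε := by
  induction m with
  | zero => exact fun u _ => ⟨0, fun A _ => ⟨A, ⟨le_rfl, by linarith⟩, by simp⟩⟩
  | succ m ih =>
    intro u hu
    obtain ⟨T', hT'⟩ := ih (fun j => u (j + 1)) fun j => hu (j + 1)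
    set δ := min (ε / 2) (1 / 2) with hδ
    have hδ0 : 0 < δ := lt_min (by linarith) (by norm_num)
    have hδ1 : δ ≤ 1 / 2 := min_le_right _ _
    have hδε : δ ≤ ε / 2 := min_le_left _ _
    set B := max (max T' (7 / δ)) 1 with hB
    have hB1 : 1 ≤ B := le_max_right _ _
    refine ⟨Real.log B, fun A hA => ?_⟩
    obtain ⟨x₀, hx₀, hsin⟩ := Real.sin_periodic.exists_mem_Ico Real.two_pi_pos
      (Real.arcsin (u 0)) A
    rw [Real.sin_arcsin (hu 0).1 (hu 0).2] at hsin
    have hexp : B ≤ Real.exp x₀ := by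
      rw [← Real.log_le_iff_le_exp (by linarith)]
      exact hA.trans hx₀.1
    have hgap : Real.exp x₀ + 7 ≤ Real.exp (x₀ + δ) := by
      rw [Real.exp_add]
      have h1 := Real.add_one_le_exp δ
      have h2 : 7 / δ ≤ Real.exp x₀ :=
        ((le_max_right _ _).trans (le_max_left _ _)).trans hexp
      rw [div_le_iff₀ hδ0] at h2
      nlinarith [Real.exp_pos x₀]
    obtain ⟨z', hz', hz'u⟩ := hT' (Real.exp x₀)
      (((le_max_left _ _).trans (le_max_left _ _)).trans hexp)
    have hz'0 : 0 < z' := (Real.exp_pos x₀).trans_le hz'.1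
    have hl1 : x₀ ≤ Real.log z' := (Real.le_log_iff_exp_le hz'0).2 hz'.1
    have hl2 : Real.log z' ≤ x₀ + δ := (Real.log_le_iff_le_exp hz'0).2 (hz'.2.trans hgap)
    refine ⟨Real.log z', ⟨hx₀.1.trans hl1, ?_⟩, fun j hj => ?_⟩
    · have := hx₀.2
      have := Real.pi_lt_d2
      linarith
    · rcases j with _ | j
      · rw [Function.iterate_zero_apply, hsin]
        have h1 : |Real.sin (Real.log z') - Real.sin x₀| ≤ |Real.log z' - x₀| := by
          simpa [Real.dist_eq] using Real.lipschitzWith_sin.dist_le_mul (Real.log z') x₀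
        refine h1.trans_lt ?_
        rw [abs_of_nonneg (by linarith)]
        linarith
      · rw [Function.iterate_succ_apply, Real.exp_log hz'0]
        exact hz'u j (by omega)

/-- An analytic curve whose image is dense in a cube. -/
noncomputable def sinExpCurve (m : ℕ) (t : ℝ) : Fin m → ℝ :=
  fun j => Real.sin (Real.exp^[(j : ℕ)] t)

theorem analyticOnNhd_iterate_exp (j : ℕ) : AnalyticOnNhd ℝ (Real.exp^[j]) Set.univ := by
  induction j with
  | zero => exact fun x _ => analyticAt_id
  | succ j ih =>
    rw [Function.iterate_succ']
    exact fun x _ => AnalyticAt.comp (analyticAt_rexp) (ih x trivial)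

theorem analyticOnNhd_sinExpCurve (m : ℕ) : AnalyticOnNhd ℝ (sinExpCurve m) Set.univ := by
  intro x _
  rw [analyticAt_pi_iff]
  exact fun j => AnalyticAt.comp Real.analyticAt_sin (analyticOnNhd_iterate_exp j x trivial)

open Topology in
theorem eq_zero_of_comp_sinExpCurve {m : ℕ} {φ : (Fin m → ℝ) → ℝ}
    (hφ : AnalyticOnNhd ℝ φ Set.univ) (y : Fin m → ℝ) (h : ∀ t, φ (y + sinExpCurve m t) = 0) :
    φ = 0 := by
  have hcont : Continuous φ := continuousOn_univ.1 hφ.continuousOn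
  have hcl : IsClosed {u | φ (y + u) = 0} := isClosed_eq (by fun_prop) continuous_const
  have hball : ∀ u ∈ Metric.ball (0 : Fin m → ℝ) 1, φ (y + u) = 0 := by
    intro u hu
    rw [mem_ball_zero_iff] at hu
    have hu' : ∀ j, |u j| < 1 := fun j => (norm_le_pi_norm u j).trans_lt hu
    suffices u ∈ closure (Set.range (sinExpCurve m)) from
      (closure_minimal (by rintro _ ⟨t, rfl⟩; exact h t) hcl) this
    rw [Metric.mem_closure_iff]
    intro ε hε
    obtain ⟨T, hT⟩ := exists_sin_iterate_exp_near m hε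
      (fun j => if hj : j < m then u ⟨j, hj⟩ else 0) (by
        intro j
        by_cases hj : j < m
        · simpa [hj] using abs_le.1 (hu' ⟨j, hj⟩).le
        · simp [hj])
    obtain ⟨z, -, hz⟩ := hT T le_rfl
    refine ⟨_, ⟨z, rfl⟩, ?_⟩
    rw [dist_pi_lt_iff hε]
    intro j
    have := hz j j.2
    rw [dist_comm, Real.dist_eq]
    simpa [sinExpCurve] using this
  have hev : φ =ᶠ[𝓝 y] fun _ => 0 := by
    filter_upwards [Metric.ball_mem_nhds y one_pos] with z hz
    have := hball (z - y) (by simpa [dist_eq_norm] using hz)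
    rwa [add_sub_cancel] at this
  exact hφ.eq_of_eventuallyEq (fun _ _ => analyticAt_const) hev

open Filter in
/-- Almost every point of a nondegenerate analytic manifold is extremal. -/
theorem ae_isExtremal {m K : ℕ} (hK : 1 ≤ K) {f : Fin K → (Fin m → ℝ) → ℝ}
    (hf : ∀ k, AnalyticOnNhd ℝ (f k) Set.univ) (hli : LinearIndependent ℝ f) :
    ∀ᵐ y : Fin m → ℝ, IsExtremal (WithLp.toLp 2 fun k => f k y) := by
  have hcurve : ∀ y : Fin m → ℝ, ∀ᵐ t : ℝ,
      IsExtremal (WithLp.toLp 2 fun k => f k (y + sinExpCurve m t)) := by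
    intro y
    refine ae_isExtremal_curve hK (fun k => ?_) fun u hu => ?_
    · intro t _
      exact AnalyticAt.comp (g := f k) (hf k _ trivial)
        (analyticAt_const.add (analyticOnNhd_sinExpCurve m t trivial))
    · by_contra! hcon
      apply hu
      have hzero : (fun y => ∑ k, u k * f k y) = 0 := by
        refine eq_zero_of_comp_sinExpCurve (fun y _ => Finset.analyticAt_fun_sum _ fun k _ =>
          analyticAt_const.mul (hf k y trivial)) y fun t => ?_
        have := hcon t
        simpa [PiLp.inner_apply, mul_comm] using this
      have := Fintype.linearIndependent_iff.1 hli (fun k => u k) (by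
        funext y
        simpa using congrFun hzero y)
      ext k
      exact this k
  have hmeas : MeasurableSet {x : (Fin m → ℝ) × ℝ |
      IsExtremal (WithLp.toLp 2 fun k => f k (x.1 + sinExpCurve m x.2))} := by
    have hfc : ∀ k, Continuous (f k) := fun k => continuousOn_univ.1 (hf k).continuousOn
    have hγ : Continuous (sinExpCurve m) :=
      continuousOn_univ.1 (analyticOnNhd_sinExpCurve m).continuousOn
    have hF : Continuous fun x : (Fin m → ℝ) × ℝ =>
        (WithLp.toLp 2 fun k => f k (x.1 + sinExpCurve m x.2) : EuclideanSpace ℝ (Fin K)) :=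
      (PiLp.continuous_toLp 2 _).comp (continuous_pi fun k => (hfc k).comp (by fun_prop))
    exact hF.measurable measurableSet_isExtremal
  have hswap := (Measure.ae_ae_comm (μ := (volume : Measure (Fin m → ℝ)))
    (ν := (volume : Measure ℝ)) hmeas).1 (Eventually.of_forall hcurve)
  obtain ⟨t, ht⟩ := hswap.exists
  exact (eventually_add_right_iff volume (sinExpCurve m t)
    (p := fun y => IsExtremal (WithLp.toLp 2 fun k => f k y))).1 ht

/-- The computation rate at an extremal point is at most `(1 / K + 1 / (p + 1)) / 2` times the
rate of a point-to-point channel, up to a bounded error. -/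
theorem IsExtremal.eventually_rate_le {K : ℕ} (hK : 1 ≤ K) {h : Fin K → ℝ}
    (hh : IsExtremal (WithLp.toLp 2 h : EuclideanSpace ℝ (Fin K))) (p : ℕ) :
    ∀ᶠ S : ℝ in Filter.atTop, (⨆ a : {a : Fin K → ℤ // a ≠ 0}, (1 / 2 : ℝ) * Real.logb 2 (S /
      (⨅ β : ℝ, S * (∑ i, (β * h i - (a.1 i : ℝ)) ^ 2) + β ^ 2))) ≤
        1 / 2 * ((1 / K + 1 / (p + 1)) * (1 + Real.logb 2 S)) := by
  obtain ⟨N, hN⟩ := Filter.eventually_atTop.1 (hh p)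
  filter_upwards [Filter.eventually_ge_atTop ((2 : ℝ) ^ N)] with S hSN
  have hS1 : 1 ≤ S := (one_le_pow₀ one_le_two).trans hSN
  have hS0 : 0 < S := by linarith
  obtain ⟨n, hn1, hn2⟩ := exists_nat_pow_near hS1 (one_lt_two (α := ℝ))
  have hNn : N ≤ n + 1 := ((pow_lt_pow_iff_right₀ one_lt_two).1 (hSN.trans_lt hn2)).le
  set κ : ℝ := 1 / K + 1 / (p + 1) with hκ
  have hκ0 : 0 ≤ κ := by positivity
  have : Nonempty {a : Fin K → ℤ // a ≠ 0} :=
    ⟨⟨fun _ => 1, fun h0 => one_ne_zero (congrFun h0 ⟨0, hK⟩)⟩⟩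
  refine ciSup_le fun a => ?_
  have hinf : S * (2 * S) ^ (-κ) ≤
      ⨅ β : ℝ, S * (∑ i, (β * h i - (a.1 i : ℝ)) ^ 2) + β ^ 2 := by
    refine le_ciInf fun β => ?_
    have h1 := hN (n + 1) hNn a.1 a.2 β
    have h2 : ‖β • (WithLp.toLp 2 h : EuclideanSpace ℝ (Fin K)) - intVec a.1‖ ^ 2 =
        ∑ i, (β * h i - (a.1 i : ℝ)) ^ 2 := by
      simp [EuclideanSpace.real_norm_sq_eq, intVec]
    rw [h2] at h1
    have h3 : (2 * S) ^ (-κ) ≤ ((2 : ℝ) ^ (n + 1)) ^ (-κ) :=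
      Real.rpow_le_rpow_of_nonpos (by positivity) (by rw [pow_succ]; linarith) (by linarith)
    have h4 : β ^ 2 / 2 ^ (n + 1) ≤ β ^ 2 / S := by gcongr
    calc S * (2 * S) ^ (-κ) ≤ S * (∑ i, (β * h i - (a.1 i : ℝ)) ^ 2 + β ^ 2 / S) := by
          gcongr; linarith
      _ = _ := by field_simp
  have hpos : 0 < S * (2 * S) ^ (-κ) := by positivity
  have hratio : S / (⨅ β : ℝ, S * (∑ i, (β * h i - (a.1 i : ℝ)) ^ 2) + β ^ 2) ≤ (2 * S) ^ κ := by
    rw [div_le_iff₀ (hpos.trans_le hinf)]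
    calc S = (2 * S) ^ κ * (S * (2 * S) ^ (-κ)) := by
          rw [Real.rpow_neg (by positivity)]; field_simp
      _ ≤ _ := by gcongr
  have hlog := Real.logb_le_logb_of_le one_lt_two (div_pos hS0 (hpos.trans_le hinf)) hratio
  rw [Real.logb_rpow_eq_mul_logb_of_pos (by positivity), Real.logb_mul two_ne_zero hS0.ne',
    Real.logb_self_eq_one one_lt_two] at hlog
  gcongr

theorem limsup_le_of_forall_eventually_le {u : ℝ → ℝ} {b : ℝ} (hb : 0 ≤ b)
    (h : ∀ δ > 0, ∀ᶠ x in Filter.atTop, u x ≤ b + δ) : Filter.limsup u Filter.atTop ≤ b := by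
  rw [Filter.limsup_eq]
  by_cases hbdd : BddBelow {a | ∀ᶠ x in Filter.atTop, u x ≤ a}
  · exact le_of_forall_pos_le_add fun δ hδ => csInf_le hbdd (h δ hδ)
  · rwa [Real.sInf_of_not_bddBelow hbdd]

open Filter in
theorem IsExtremal.limsup_rate_le {K : ℕ} (hK : 1 ≤ K) {h : Fin K → ℝ}
    (hh : IsExtremal (WithLp.toLp 2 h : EuclideanSpace ℝ (Fin K))) :
    limsup (fun S : ℝ => (⨆ a : {a : Fin K → ℤ // a ≠ 0}, (1 / 2 : ℝ) * Real.logb 2 (S /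
      (⨅ β : ℝ, S * (∑ i, (β * h i - (a.1 i : ℝ)) ^ 2) + β ^ 2))) /
        ((1 / 2 : ℝ) * Real.logb 2 (1 + S))) atTop ≤ 1 / K := by
  refine limsup_le_of_forall_eventually_le (by positivity) fun δ hδ => ?_
  obtain ⟨p, hp⟩ := exists_nat_one_div_lt (half_pos hδ)
  set κ : ℝ := 1 / K + 1 / (p + 1) with hκ
  have hκ0 : 0 ≤ κ := by positivity
  have hlim : Tendsto (fun S : ℝ => Real.logb 2 (1 + S)) atTop atTop :=
    (Real.tendsto_logb_atTop one_lt_two).comp (tendsto_atTop_add_const_left _ _ tendsto_id)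
  filter_upwards [hh.eventually_rate_le hK p, hlim.eventually_ge_atTop (2 * κ / δ),
    eventually_ge_atTop (1 : ℝ)] with S hS hlarge hS1
  have hL : Real.logb 2 S ≤ Real.logb 2 (1 + S) :=
    Real.logb_le_logb_of_le one_lt_two (by linarith) (by linarith)
  have hL0 : 0 < Real.logb 2 (1 + S) := Real.logb_pos one_lt_two (by linarith)
  rw [div_le_iff₀ hδ] at hlarge
  rw [div_le_iff₀ (by positivity)]
  refine hS.trans ?_
  have h1 : κ * (1 + Real.logb 2 S) ≤ κ * (1 + Real.logb 2 (1 + S)) := by gcongr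
  have h2 : κ * Real.logb 2 (1 + S) ≤ (1 / K + δ / 2) * Real.logb 2 (1 + S) := by
    rw [hκ]; gcongr
  linarith

/-- Let `f₁,…,f_K : ℝ^m → ℝ` be real analytic and, together with the constant function
`1`, linearly independent over `ℝ`. Then for Lebesgue-almost every parameter
`h̃ ∈ ℝ^m`, the point `h = (f₁(h̃),…,f_K(h̃))` of the manifold has highest computation
rate with degrees-of-freedom at most `1/K`. -/
theorem stmt16 (m K : ℕ) (hm : 1 ≤ m) (hK : 1 ≤ K)
    (f : Fin K → ((Fin m → ℝ) → ℝ))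
    (hanalytic : ∀ k, AnalyticOnNhd ℝ (f k) Set.univ)
    (hindep : LinearIndependent ℝ
      (Fin.cons (fun _ => (1 : ℝ)) f : Fin (K + 1) → (Fin m → ℝ) → ℝ)) :
    ∀ᵐ htil : Fin m → ℝ ∂volume,
      Filter.limsup (fun SNR : ℝ =>
          (⨆ a : {a : Fin K → ℤ // a ≠ 0},
              (1 / 2 : ℝ) * Real.logb 2 (SNR /
                (⨅ β : ℝ, SNR * (∑ i, (β * f i htil - (a.1 i : ℝ)) ^ 2) + β ^ 2)))
            / ((1 / 2 : ℝ) * Real.logb 2 (1 + SNR)))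
        Filter.atTop ≤ 1 / K := by
  have hli : LinearIndependent ℝ f := by
    have h := hindep.comp Fin.succ (Fin.succ_injective K)
    have e : (Fin.cons (fun _ => (1 : ℝ)) f : Fin (K + 1) → (Fin m → ℝ) → ℝ) ∘ Fin.succ = f := by
      funext k
      simp
    rwa [e] at h
  filter_upwards [ae_isExtremal hK hanalytic hli] with y hy
  exact hy.limsup_rate_le hK
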